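/- arXiv:2403.07421 — 11 statements merged into one kernel-verified Lean document; each statement's English description precedes it below -/
import Mathlib

section
/- Let X be a separable metrizable space. Then X is σ-compact if and only if the space AM(X) of bounded admissible metrics on X, endowed with the sup-metric, is completely metrizable. -/
open Set Filter Topology UniformConvergence

/-- `d : X × X → ℝ` is a metric on `X`. -/
def IsMetricFun {X : Type*} (d : X × X → ℝ) : Prop :=
  (∀ x y : X, d (x, y) = 0 ↔ x = y) ∧ (∀ x y : X, d (x, y) = d (y, x)) ∧
    (∀ x y z : X, d (x, z) ≤ d (x, y) + d (y, z))

/-- `d` induces the topology of `X`, i.e. `d` is an admissible metric. -/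
def InducesTopology {X : Type*} [TopologicalSpace X] (d : X × X → ℝ) : Prop :=
  ∀ s : Set X, IsOpen s ↔ ∀ x ∈ s, ∃ ε > 0, ∀ y : X, d (x, y) < ε → y ∈ s

/-- `d` is a bounded real-valued function. -/
def BoundedFun {X : Type*} (d : X × X → ℝ) : Prop := ∃ C : ℝ, ∀ p : X × X, |d p| ≤ C

/-- `AM X`: the set of bounded admissible metrics on `X`, regarded as a subset of the space
`C(X²)` of bounded continuous real-valued functions on `X × X`, which carries the
sup-metric (every admissible metric is continuous on `X × X`, so bounded admissible
metrics are exactly the elements of `C(X²)` satisfying the two conditions below). -/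
def AM (X : Type*) [TopologicalSpace X] : Set (BoundedContinuousFunction (X × X) ℝ) :=
  {f | IsMetricFun (⇑f) ∧ InducesTopology (⇑f)}

/-- A topological space is completely metrizable if its topology is induced by some
complete metric. -/
def CompletelyMetrizable (Z : Type*) [t : TopologicalSpace Z] : Prop :=
  ∃ m : MetricSpace Z, m.toPseudoMetricSpace.toUniformSpace.toTopologicalSpace = t ∧
    @CompleteSpace Z m.toPseudoMetricSpace.toUniformSpace

/-! ### Completely metrizable subspaces and `Gδ` sets -/

/-- A completely metrizable subspace of a metrizable space is a `Gδ` set. -/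
theorem CompletelyMetrizable.isGδ {M : Type*} [TopologicalSpace M]
    [TopologicalSpace.MetrizableSpace M] {A : Set M} (hA : CompletelyMetrizable A) : IsGδ A := by
  let := TopologicalSpace.metrizableSpaceMetric M
  obtain ⟨m, ht, hc⟩ := hA
  let G : ℕ → Set M := fun n => {z | ∃ U : Set M, IsOpen U ∧ z ∈ U ∧
    ∀ a b : A, (a : M) ∈ U → (b : M) ∈ U → m.dist a b < 1 / ((n : ℝ) + 1)}
  have hG : ∀ n, IsOpen (G n) := by
    intro n
    rw [isOpen_iff_mem_nhds]
    rintro z ⟨U, hU, hz, h⟩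
    exact mem_of_superset (hU.mem_nhds hz) fun w hw => ⟨U, hU, hw, h⟩
  have hAG : A = closure A ∩ ⋂ n, G n := by
    ext z
    constructor
    · refine fun hz => ⟨subset_closure hz, mem_iInter.2 fun n => ?_⟩
      have hpos : (0 : ℝ) < 1 / ((n : ℝ) + 1) / 2 := by positivity
      have hb : @IsOpen A instTopologicalSpaceSubtype
          (@Metric.ball A m.toPseudoMetricSpace ⟨z, hz⟩ (1 / ((n : ℝ) + 1) / 2)) := by
        rw [← ht]
        exact @Metric.isOpen_ball A m.toPseudoMetricSpace _ _
      obtain ⟨U, hU, hUb⟩ := isOpen_induced_iff.1 hb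
      have key : ∀ a : A, (a : M) ∈ U ↔ m.dist a ⟨z, hz⟩ < 1 / ((n : ℝ) + 1) / 2 := fun a =>
        Set.ext_iff.1 hUb a
      refine ⟨U, hU, (key ⟨z, hz⟩).2 (by rw [m.dist_self]; exact hpos), fun a b ha hb' => ?_⟩
      have h1 := (key a).1 ha
      have h2 := (key b).1 hb'
      have h3 := m.dist_triangle a ⟨z, hz⟩ b
      rw [m.dist_comm ⟨z, hz⟩ b] at h3
      linarith
    · rintro ⟨hz, hzG⟩
      have hne : (comap ((↑) : A → M) (𝓝 z)).NeBot := mem_closure_iff_comap_neBot.1 hz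
      have hcau : @Cauchy A m.toUniformSpace (comap ((↑) : A → M) (𝓝 z)) := by
        let := m.toPseudoMetricSpace
        refine Metric.cauchy_iff.2 ⟨hne, fun ε hε => ?_⟩
        obtain ⟨n, hn⟩ := exists_nat_one_div_lt hε
        obtain ⟨U, hU, hzU, h⟩ := mem_iInter.1 hzG n
        exact ⟨_, preimage_mem_comap (hU.mem_nhds hzU), fun a ha b hb => (h a b ha hb).trans hn⟩
      obtain ⟨a, ha⟩ := hc.complete hcau
      have ha' : comap ((↑) : A → M) (𝓝 z) ≤ 𝓝 a := by
        rw [ht] at ha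
        exact ha
      have hlim : Tendsto ((↑) : A → M) (comap ((↑) : A → M) (𝓝 z)) (𝓝 (a : M)) :=
        continuous_subtype_val.continuousAt.mono_left ha'
      rw [tendsto_nhds_unique tendsto_comap hlim]
      exact a.2
  rw [hAG]
  exact isClosed_closure.isGδ.inter (.iInter_of_isOpen hG)

/-- An open subset of a metrizable space is a cozero set. -/
theorem IsOpen.exists_continuous_eq_zero_iff {M : Type*} [TopologicalSpace M]
    [TopologicalSpace.MetrizableSpace M] {U : Set M} (hU : IsOpen U) :
    ∃ g : M → ℝ, Continuous g ∧ ∀ x, g x = 0 ↔ x ∉ U := by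
  let := TopologicalSpace.metrizableSpaceMetric M
  rcases (Uᶜ).eq_empty_or_nonempty with h | h
  · refine ⟨fun _ => 1, continuous_const, fun x => ?_⟩
    have hx : x ∈ U := by simp [compl_empty_iff.1 h]
    simp [hx]
  · exact ⟨fun x => Metric.infDist x Uᶜ, Metric.continuous_infDist_pt _,
      fun x => (hU.isClosed_compl.mem_iff_infDist_zero h).symm⟩

/-- A `Gδ` subspace of a completely metrizable space is completely metrizable. -/
theorem IsGδ.isCompletelyMetrizableSpace {M : Type*} [TopologicalSpace M]
    [TopologicalSpace.IsCompletelyMetrizableSpace M] {A : Set M} (hA : IsGδ A) :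
    TopologicalSpace.IsCompletelyMetrizableSpace A := by
  obtain ⟨U, hU, rfl⟩ := hA.eq_iInter_nat
  choose g hg hgU using fun n => (hU n).exists_continuous_eq_zero_iff
  have hne : ∀ (x : ↥(⋂ n, U n)) n, g n x ≠ 0 := fun x n h =>
    (hgU n x).1 h (mem_iInter.1 x.2 n)
  let F : ↥(⋂ n, U n) → M × (ℕ → ℝ) := fun x => (x, fun n => (g n x)⁻¹)
  have hF : Continuous F := continuous_subtype_val.prodMk
    (continuous_pi fun n => ((hg n).comp continuous_subtype_val).inv₀ fun x => hne x n)
  have hrange : range F = {p | ∀ n, p.2 n * g n p.1 = 1} := by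
    ext ⟨x, t⟩
    constructor
    · rintro ⟨y, hy⟩ n
      rw [← hy]
      exact inv_mul_cancel₀ (hne y n)
    · intro h
      have hx : x ∈ ⋂ n, U n := by
        refine mem_iInter.2 fun n => ?_
        by_contra hx
        have h' := h n
        simp [(hgU n x).2 hx] at h'
      exact ⟨⟨x, hx⟩, Prod.ext rfl (funext fun n => (eq_inv_of_mul_eq_one_left (h n)).symm)⟩
  have hclosed : IsClosed (range F) := by
    rw [hrange, ofPred_forall]
    exact isClosed_iInter fun n => isClosed_eq
      (((continuous_apply n).comp continuous_snd).mul ((hg n).comp continuous_fst))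
      continuous_const
  exact IsClosedEmbedding.IsCompletelyMetrizableSpace
    ⟨.of_comp hF continuous_fst .subtypeVal, hclosed⟩

/-! ### Admissible metrics -/

theorem mem_AM_iff {X : Type*} [TopologicalSpace X]
    {f : BoundedContinuousFunction (X × X) ℝ} :
    f ∈ AM X ↔ IsMetricFun f ∧ ∀ x, ∀ U ∈ 𝓝 x, ∃ ε > 0, ∀ y, f (x, y) < ε → y ∈ U := by
  refine and_congr_right fun hf => ⟨fun h x U hU => ?_, fun h s => ⟨fun hs x hx => ?_, fun hs => ?_⟩⟩
  · obtain ⟨ε, hε, hy⟩ := (h (interior U)).1 isOpen_interior x (mem_interior_iff_mem_nhds.2 hU)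
    exact ⟨ε, hε, fun y hxy => interior_subset (hy y hxy)⟩
  · exact h x s (hs.mem_nhds hx)
  · rw [isOpen_iff_mem_nhds]
    intro x hx
    obtain ⟨ε, hε, hy⟩ := hs x hx
    have hc : Continuous fun y => f (x, y) := by fun_prop
    refine mem_of_superset (hc.continuousAt.preimage_mem_nhds (Iio_mem_nhds ?_)) fun y => hy y
    rw [(hf.1 x x).2 rfl]
    exact hε

/-- If `X` is σ-compact, then `AM X` is a `Gδ` set. -/
theorem isGδ_AM (X : Type*) [TopologicalSpace X] [TopologicalSpace.MetrizableSpace X]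
    [SigmaCompactSpace X] : IsGδ (AM X) := by
  let := TopologicalSpace.metrizableSpaceMetric X
  let P : Set (BoundedContinuousFunction (X × X) ℝ) :=
    {f | (∀ x, f (x, x) = 0) ∧ (∀ x y, f (x, y) = f (y, x)) ∧
      ∀ x y z, f (x, z) ≤ f (x, y) + f (y, z)}
  let G : ℕ → ℕ → Set (BoundedContinuousFunction (X × X) ℝ) := fun n k =>
    {f | ∃ ε > 0, ∀ x ∈ compactCovering X n, ∀ y, 1 / ((k : ℝ) + 1) ≤ dist x y → ε ≤ f (x, y)}
  have hev : ∀ p : X × X, Continuous fun f : BoundedContinuousFunction (X × X) ℝ => f p :=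
    fun p => continuous_eval_const p
  have hP : IsClosed P := by
    simp only [P, ofPred_and, ofPred_forall]
    refine .inter ?_ (.inter ?_ ?_)
    · exact isClosed_iInter fun x => isClosed_eq (hev _) continuous_const
    · exact isClosed_iInter fun x => isClosed_iInter fun y => isClosed_eq (hev _) (hev _)
    · exact isClosed_iInter fun x => isClosed_iInter fun y => isClosed_iInter fun z =>
        isClosed_le (hev _) ((hev _).add (hev _))
  have hG : ∀ n k, IsOpen (G n k) := by
    intro n k
    rw [Metric.isOpen_iff]
    rintro f ⟨ε, hε, h⟩
    refine ⟨ε / 2, half_pos hε, fun g hg => ⟨ε / 2, half_pos hε, fun x hx y hxy => ?_⟩⟩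
    have h1 := h x hx y hxy
    have h2 := (g.dist_coe_le_dist (g := f) (x, y)).trans_lt hg
    rw [Real.dist_eq, abs_lt] at h2
    linarith
  have hAM : AM X = P ∩ ⋂ n, ⋂ k, G n k := by
    ext f
    constructor
    · intro hf
      obtain ⟨hm, hU⟩ := mem_AM_iff.1 hf
      refine ⟨⟨fun x => (hm.1 x x).2 rfl, hm.2⟩, mem_iInter.2 fun n => mem_iInter.2 fun k => ?_⟩
      by_contra hcon
      have hcon' : ∀ j : ℕ, ∃ x ∈ compactCovering X n, ∃ y, 1 / ((k : ℝ) + 1) ≤ dist x y ∧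
          f (x, y) < 1 / ((j : ℝ) + 1) := by
        intro j
        by_contra! h
        exact hcon ⟨1 / ((j : ℝ) + 1), by positivity, h⟩
      choose x hx y hxy hfxy using hcon'
      obtain ⟨a, -, φ, hφ, hlim⟩ := (isCompact_compactCovering X n).tendsto_subseq hx
      have hfa : Tendsto (fun j => f (a, x (φ j))) atTop (𝓝 0) := by
        have hc : Continuous fun z => f (a, z) := by fun_prop
        have := (hc.tendsto a).comp hlim
        rwa [(hm.1 a a).2 rfl] at this
      have hfy : Tendsto (fun j => f (a, x (φ j)) + 1 / ((φ j : ℝ) + 1)) atTop (𝓝 0) := by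
        simpa using hfa.add (tendsto_one_div_add_atTop_nhds_zero_nat.comp hφ.tendsto_atTop)
      have hylim : Tendsto (fun j => y (φ j)) atTop (𝓝 a) := by
        refine tendsto_def.2 fun U hUa => ?_
        obtain ⟨ε, hε, h⟩ := hU a U hUa
        filter_upwards [hfy.eventually (gt_mem_nhds hε)] with j hj
        refine h _ ?_
        have := hm.2.2 a (x (φ j)) (y (φ j))
        have := hfxy (φ j)
        linarith
      have hd : Tendsto (fun j => dist (x (φ j)) (y (φ j))) atTop (𝓝 0) := by
        simpa using hlim.dist hylim
      have := ge_of_tendsto' hd fun j => hxy (φ j)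
      have : (0 : ℝ) < 1 / ((k : ℝ) + 1) := by positivity
      linarith
    · rintro ⟨⟨h0, hsymm, htri⟩, hfG⟩
      have key : ∀ (x : X) (δ : ℝ), 0 < δ → ∃ ε > 0, ∀ y, f (x, y) < ε → dist x y < δ := by
        intro x δ hδ
        obtain ⟨k, hk⟩ := exists_nat_one_div_lt hδ
        obtain ⟨n, hn⟩ := mem_iUnion.1 ((iUnion_compactCovering X).symm ▸ mem_univ x)
        obtain ⟨ε, hε, h⟩ := mem_iInter.1 (mem_iInter.1 hfG n) k
        refine ⟨ε, hε, fun y hy => ?_⟩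
        by_contra! hxy
        exact (h x hn y (hk.le.trans hxy)).not_gt hy
      refine mem_AM_iff.2 ⟨⟨fun x y => ⟨fun hxy => ?_, fun hxy => hxy ▸ h0 x⟩, hsymm, htri⟩,
        fun x U hU => ?_⟩
      · by_contra hne
        obtain ⟨ε, hε, h⟩ := key x (dist x y) (dist_pos.2 hne)
        exact lt_irrefl _ (h y (hxy.trans_lt hε))
      · obtain ⟨δ, hδ, hball⟩ := Metric.mem_nhds_iff.1 hU
        obtain ⟨ε, hε, h⟩ := key x δ hδ
        exact ⟨ε, hε, fun y hy => hball (by rw [Metric.mem_ball, dist_comm]; exact h y hy)⟩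
  rw [hAM]
  exact hP.isGδ.inter (.iInter fun n => .iInter_of_isOpen (hG n))

/-! ### Gluing two points -/

/-- The pseudometric on `Y` obtained by gluing the points `p` and `q`. -/
noncomputable def glueDist {Y : Type*} [MetricSpace Y] (p q a b : Y) : ℝ :=
  min (dist a b) (min (dist a p + dist q b) (dist a q + dist p b))

section glueDist

variable {Y : Type*} [MetricSpace Y] (p q : Y)

theorem glueDist_le_dist (a b : Y) : glueDist p q a b ≤ dist a b := min_le_left _ _

theorem glueDist_le_left (a b : Y) : glueDist p q a b ≤ dist a p + dist q b :=
  (min_le_right _ _).trans (min_le_left _ _)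

theorem glueDist_le_right (a b : Y) : glueDist p q a b ≤ dist a q + dist p b :=
  (min_le_right _ _).trans (min_le_right _ _)

theorem glueDist_cases (a b : Y) :
    glueDist p q a b = dist a b ∨ glueDist p q a b = dist a p + dist q b ∨
      glueDist p q a b = dist a q + dist p b :=
  (min_choice _ _).imp_right fun h =>
    (min_choice (dist a p + dist q b) (dist a q + dist p b)).imp h.trans h.trans

theorem glueDist_comm (a b : Y) : glueDist p q a b = glueDist p q b a := by
  unfold glueDist
  rw [dist_comm a b, min_comm (dist a p + _), dist_comm a p, dist_comm a q, dist_comm q b,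
    dist_comm p b, add_comm (dist q a), add_comm (dist p a)]

theorem glueDist_triangle (a b c : Y) :
    glueDist p q a c ≤ glueDist p q a b + glueDist p q b c := by
  have := glueDist_le_dist p q a c
  have := glueDist_le_left p q a c
  have := glueDist_le_right p q a c
  have := dist_triangle a b c
  have := dist_triangle a b p
  have := dist_triangle a b q
  have := dist_triangle p b c
  have := dist_triangle q b c
  have := dist_triangle a p c
  have := dist_triangle a q c
  have := dist_comm b p
  have := dist_comm b q
  have : 0 ≤ dist b p := dist_nonneg
  have : 0 ≤ dist b q := dist_nonneg
  rcases glueDist_cases p q a b with h | h | h <;>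
  rcases glueDist_cases p q b c with h' | h' | h' <;>
  linarith

theorem glueDist_nonneg (a b : Y) : 0 ≤ glueDist p q a b := by
  unfold glueDist
  positivity

theorem glueDist_self (a : Y) : glueDist p q a a = 0 :=
  le_antisymm ((glueDist_le_dist p q a a).trans_eq (dist_self a)) (glueDist_nonneg p q a a)

theorem glueDist_le_add_dist (y y' a b : Y) :
    glueDist y q a b ≤ glueDist y' q a b + dist y y' := by
  have h1 := dist_triangle a y' y
  have h2 := dist_triangle y y' b
  rw [dist_comm y' y] at h1
  have h3 : 0 ≤ dist y y' := dist_nonneg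
  have := glueDist_le_dist y q a b
  have := glueDist_le_left y q a b
  have := glueDist_le_right y q a b
  rcases glueDist_cases y' q a b with h | h | h <;> linarith

theorem continuous_glueDist :
    Continuous fun z : Y × Y × Y × Y => glueDist z.1 z.2.1 z.2.2.1 z.2.2.2 := by
  unfold glueDist
  fun_prop

variable {p q}

theorem dist_lt_of_glueDist_lt {a b : Y} {ε : ℝ} (hp : ε ≤ dist a p) (hq : ε ≤ dist a q)
    (h : glueDist p q a b < ε) : dist a b < ε := by
  have h1 : 0 ≤ dist q b := dist_nonneg
  have h2 : 0 ≤ dist p b := dist_nonneg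
  rcases glueDist_cases p q a b with h' | h' | h' <;> linarith

end glueDist

/-- The gluing pseudometrics with one glued point fixed and pulled back along `e`, as a function
of the other glued point. -/
noncomputable def gluePullback {X Y : Type*} [TopologicalSpace X] [MetricSpace Y]
    [CompactSpace Y] (e : C(X, Y)) (q y : Y) : BoundedContinuousFunction (X × X) ℝ :=
  (BoundedContinuousFunction.mkOfCompact
    (⟨fun z : Y × Y => glueDist y q z.1 z.2, continuous_glueDist.comp
      (g := fun z : Y × Y × Y × Y => glueDist z.1 z.2.1 z.2.2.1 z.2.2.2)
      (f := fun z : Y × Y => (y, q, z.1, z.2)) (by fun_prop)⟩ :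
      C(Y × Y, ℝ))).compContinuous (e.prodMap e)

section gluePullback

variable {X Y : Type*} [TopologicalSpace X] [MetricSpace Y] [CompactSpace Y]

@[simp]
theorem gluePullback_apply (e : C(X, Y)) (q y : Y) (a b : X) :
    gluePullback e q y (a, b) = glueDist y q (e a) (e b) := rfl

theorem continuous_gluePullback (e : C(X, Y)) (q : Y) : Continuous (gluePullback e q) := by
  refine LipschitzWith.continuous (K := 1) (LipschitzWith.of_dist_le_mul fun y y' => ?_)
  rw [NNReal.coe_one, one_mul, BoundedContinuousFunction.dist_le dist_nonneg]
  rintro ⟨a, b⟩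
  have h1 := glueDist_le_add_dist q y y' (e a) (e b)
  have h2 := glueDist_le_add_dist q y' y (e a) (e b)
  rw [dist_comm y' y] at h2
  rw [gluePullback_apply, gluePullback_apply, Real.dist_eq, abs_le]
  constructor <;> linarith

theorem gluePullback_mem_AM_iff {e : C(X, Y)} (he : IsEmbedding e) {q : Y}
    (hq : q ∈ closure (range e)) (hq' : q ∉ range e) (y : Y) :
    gluePullback e q y ∈ AM X ↔ y ∉ range e := by
  rw [mem_AM_iff]
  constructor
  · rintro ⟨-, h⟩ ⟨x, rfl⟩
    have hxq : 0 < dist (e x) q := dist_pos.2 fun h => hq' ⟨x, h⟩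
    obtain ⟨ε, hε, hε'⟩ := h x _ (e.continuous.continuousAt.preimage_mem_nhds
      (Metric.ball_mem_nhds (e x) (half_pos hxq)))
    obtain ⟨_, ⟨z, rfl⟩, hz⟩ := Metric.mem_closure_iff.1 hq (min ε (dist (e x) q / 2))
      (lt_min hε (half_pos hxq))
    obtain ⟨hz1, hz2⟩ := lt_min_iff.1 hz
    have hz3 : dist (e z) (e x) < dist (e x) q / 2 := by
      refine hε' z ?_
      rw [gluePullback_apply]
      refine lt_of_le_of_lt (glueDist_le_left _ _ _ _) ?_
      rwa [dist_self, zero_add]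
    have := dist_triangle (e x) (e z) q
    rw [dist_comm (e x) (e z), dist_comm (e z) q] at this
    linarith
  · intro hy
    have key : ∀ (x : X) (δ : ℝ), 0 < δ → ∃ ε > 0, ∀ z,
        gluePullback e q y (x, z) < ε → dist (e x) (e z) < δ := by
      intro x δ hδ
      have h1 : 0 < dist (e x) y := dist_pos.2 fun h => hy ⟨x, h⟩
      have h2 : 0 < dist (e x) q := dist_pos.2 fun h => hq' ⟨x, h⟩
      refine ⟨min δ (min (dist (e x) y) (dist (e x) q)), lt_min hδ (lt_min h1 h2), fun z hz => ?_⟩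
      exact (dist_lt_of_glueDist_lt ((min_le_right _ _).trans (min_le_left _ _))
        ((min_le_right _ _).trans (min_le_right _ _)) hz).trans_le (min_le_left _ _)
    refine ⟨⟨fun a b => ⟨fun hab => ?_, ?_⟩, fun a b => glueDist_comm _ _ _ _,
      fun a b c => glueDist_triangle _ _ _ _ _⟩, fun x U hU => ?_⟩
    · by_contra hne
      obtain ⟨ε, hε, h⟩ := key a (dist (e a) (e b)) (dist_pos.2 (he.injective.ne hne))
      exact lt_irrefl _ (h b (hab.trans_lt hε))
    · rintro rfl
      exact glueDist_self _ _ _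
    · rw [he.isInducing.nhds_eq_comap] at hU
      obtain ⟨V, hV, hVU⟩ := hU
      obtain ⟨δ, hδ, hball⟩ := Metric.mem_nhds_iff.1 hV
      obtain ⟨ε, hε, h⟩ := key x δ hδ
      exact ⟨ε, hε, fun z hz =>
        hVU (hball (by rw [Metric.mem_ball, dist_comm]; exact h z hz))⟩

/-- A space that embeds into a compact metric space is σ-compact as soon as its set of bounded
admissible metrics is `Gδ`. -/
theorem sigmaCompactSpace_of_isGδ_AM {e : C(X, Y)} (he : IsEmbedding e) (h : IsGδ (AM X)) :
    SigmaCompactSpace X := by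
  by_cases hcl : IsClosed (range e)
  · have : CompactSpace X := IsClosedEmbedding.compactSpace ⟨he, hcl⟩
    infer_instance
  · obtain ⟨q, hq, hq'⟩ := not_subset.1 (mt closure_subset_iff_isClosed.1 hcl)
    have hpre : gluePullback e q ⁻¹' AM X = (range e)ᶜ :=
      Set.ext fun y => gluePullback_mem_AM_iff he hq hq' y
    have hGδ : IsGδ (range e)ᶜ := hpre ▸ h.preimage (continuous_gluePullback e q)
    obtain ⟨U, hU, hUe⟩ := hGδ.eq_iInter_nat
    have hrange : range e = ⋃ n, (U n)ᶜ := by rw [← compl_iInter, ← hUe, compl_compl]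
    rw [← isSigmaCompact_univ_iff, he.isInducing.isSigmaCompact_iff, image_univ]
    exact ⟨fun n => (U n)ᶜ, fun n => (hU n).isClosed_compl.isCompact, hrange.symm⟩

end gluePullback

/-- A separable metrizable space `X` is σ-compact if and only if the space
`AM(X)` of bounded admissible metrics on `X`, endowed with the sup-metric, is completely
metrizable. -/
theorem sigmaCompact_iff_completelyMetrizable_AM (X : Type*) [TopologicalSpace X]
    [TopologicalSpace.MetrizableSpace X] [TopologicalSpace.SeparableSpace X] :
    SigmaCompactSpace X ↔ CompletelyMetrizable ↥(AM X) := by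
  constructor
  · intro _
    exact (isGδ_AM X).isCompletelyMetrizableSpace.complete
  · intro h
    let := TopologicalSpace.metrizableSpaceMetric X
    let := TopologicalSpace.metrizableSpaceMetric (ℕ → unitInterval)
    obtain ⟨F, hF⟩ := Metric.PiNatEmbed.exists_embedding_to_hilbert_cube (X := X)
    exact sigmaCompactSpace_of_isGδ_AM (e := ⟨F, hF.continuous⟩) hF h.isGδ
end

section
/- Let X be a σ-compact metrizable space. Then the space AM(X) of bounded admissible metrics on X, endowed with the sup-metric, is completely metrizable. -/
open Set Filter Topology UniformConvergence

/-- In a completely metrizable space, the intersection of a closed set and countably many open sets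
is completely metrizable. -/
theorem isCompletelyMetrizableSpace_inter_iInter {E ι : Type*} [MetricSpace E] [CompleteSpace E]
    [Countable ι] {C : Set E} (hC : IsClosed C) {U : ι → Set E} (hU : ∀ i, IsOpen (U i)) :
    TopologicalSpace.IsCompletelyMetrizableSpace ↥(C ∩ ⋂ i, U i) := by
  have hcm (i : ι) : TopologicalSpace.IsCompletelyMetrizableSpace (U i) :=
    inferInstanceAs (TopologicalSpace.IsCompletelyMetrizableSpace
      (TopologicalSpace.Opens.CompleteCopy ⟨U i, hU i⟩))
  let φ : ↥(C ∩ ⋂ i, U i) → E × ((i : ι) → U i) :=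
    fun x ↦ (x.1, fun i ↦ ⟨x.1, mem_iInter.1 x.2.2 i⟩)
  have hφ : Continuous φ := by fun_prop
  have hemb : IsEmbedding φ :=
    .of_comp hφ continuous_fst (IsEmbedding.subtypeVal (p := (· ∈ C ∩ ⋂ i, U i)))
  have hrange : range φ = {p | p.1 ∈ C} ∩ ⋂ i, {p | (p.2 i : E) = p.1} := by
    ext ⟨a, g⟩
    simp only [mem_range, mem_inter_iff, mem_ofPred_eq, mem_iInter]
    constructor
    · rintro ⟨x, hx⟩
      simp only [φ, Prod.mk.injEq] at hx
      obtain ⟨rfl, rfl⟩ := hx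
      exact ⟨x.2.1, fun _ ↦ rfl⟩
    · rintro ⟨ha, hg⟩
      exact ⟨⟨a, ha, mem_iInter.2 fun i ↦ hg i ▸ (g i).2⟩,
        Prod.ext rfl (funext fun i ↦ Subtype.ext (hg i).symm)⟩
  have hclosed : IsClosed (range φ) := by
    rw [hrange]
    exact (hC.preimage continuous_fst).inter
      (isClosed_iInter fun i ↦ isClosed_eq (by fun_prop) (by fun_prop))
  exact IsClosedEmbedding.IsCompletelyMetrizableSpace ⟨hemb, hclosed⟩

/-- The bounded continuous pseudometrics on `X`. -/
def pseudometricFuns (X : Type*) [TopologicalSpace X] :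
    Set (BoundedContinuousFunction (X × X) ℝ) :=
  {f | (∀ x, f (x, x) = 0) ∧ (∀ x y, f (x, y) = f (y, x)) ∧
    ∀ x y z, f (x, z) ≤ f (x, y) + f (y, z)}

theorem isClosed_pseudometricFuns (X : Type*) [TopologicalSpace X] :
    IsClosed (pseudometricFuns X) := by
  have hev (p : X × X) : Continuous fun f : BoundedContinuousFunction (X × X) ℝ ↦ f p :=
    continuous_eval_const p
  have : pseudometricFuns X = (⋂ x, {f | f (x, x) = 0}) ∩ ((⋂ x, ⋂ y, {f | f (x, y) = f (y, x)}) ∩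
      ⋂ x, ⋂ y, ⋂ z, {f | f (x, z) ≤ f (x, y) + f (y, z)}) := by
    ext f
    simp [pseudometricFuns]
  rw [this]
  exact (isClosed_iInter fun x ↦ isClosed_eq (hev _) continuous_const).inter
    ((isClosed_iInter fun x ↦ isClosed_iInter fun y ↦ isClosed_eq (hev _) (hev _)).inter
      (isClosed_iInter fun x ↦ isClosed_iInter fun y ↦ isClosed_iInter fun z ↦
        isClosed_le (hev _) ((hev _).add (hev _))))

/-- The functions `f` for which, uniformly in `x ∈ K`, smallness of `f (x, y)` forces
`dist x y < ε`. -/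
def uniformlyControls {X : Type*} [MetricSpace X] (K : Set X) (ε : ℝ) :
    Set (BoundedContinuousFunction (X × X) ℝ) :=
  {f | ∃ δ > 0, ∀ x ∈ K, ∀ y, f (x, y) < δ → dist x y < ε}

theorem isOpen_uniformlyControls {X : Type*} [MetricSpace X] (K : Set X) (ε : ℝ) :
    IsOpen (uniformlyControls K ε) := by
  refine Metric.isOpen_iff.2 fun f ⟨δ, hδ, hf⟩ ↦ ⟨δ / 2, half_pos hδ, fun g hg ↦
    ⟨δ / 2, half_pos hδ, fun x hx y hxy ↦ hf x hx y ?_⟩⟩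
  have h := (BoundedContinuousFunction.dist_coe_le_dist (x, y)).trans_lt (Metric.mem_ball.1 hg)
  rw [Real.dist_eq, abs_lt] at h
  linarith

theorem AM_subset_uniformlyControls {X : Type*} [MetricSpace X] {K : Set X} (hK : IsCompact K)
    {ε : ℝ} (hε : 0 < ε) : AM X ⊆ uniformlyControls K ε := by
  rintro f ⟨⟨hzero, hsymm, htri⟩, htop⟩
  refine hK.induction_on (p := fun s ↦ f ∈ uniformlyControls s ε) ⟨1, one_pos, by simp⟩ ?_ ?_ ?_
  · rintro s t hst ⟨δ, hδ, h⟩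
    exact ⟨δ, hδ, fun x hx ↦ h x (hst hx)⟩
  · rintro s t ⟨δ, hδ, h⟩ ⟨η, hη, h'⟩
    refine ⟨min δ η, lt_min hδ hη, fun x hx y hxy ↦ hx.elim ?_ ?_⟩
    · exact fun hx ↦ h x hx y (hxy.trans_le (min_le_left _ _))
    · exact fun hx ↦ h' x hx y (hxy.trans_le (min_le_right _ _))
  · intro x _
    obtain ⟨r, hr, hball⟩ := (htop (Metric.ball x (ε / 2))).1 Metric.isOpen_ball x
      (Metric.mem_ball_self (half_pos hε))
    have hlt : ∀ᶠ z in 𝓝 x, f (x, z) < r / 2 := by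
      have hc : Continuous fun z ↦ f (x, z) := by fun_prop
      refine hc.continuousAt.eventually_lt continuousAt_const ?_
      rw [(hzero x x).2 rfl]
      exact half_pos hr
    refine ⟨_, mem_nhdsWithin_of_mem_nhds
      (hlt.and (Metric.ball_mem_nhds x (half_pos hε))), r / 2, half_pos hr, ?_⟩
    rintro z ⟨hz, hzx⟩ y hzy
    have hy := Metric.mem_ball.1 (hball y (by linarith [htri x z y]))
    linarith [dist_triangle_right z y x]

theorem AM_eq_inter {X : Type*} [MetricSpace X] [SigmaCompactSpace X] :
    AM X = pseudometricFuns X ∩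
      ⋂ i : ℕ × ℕ, uniformlyControls (compactCovering X i.1) (1 / ((i.2 : ℝ) + 1)) := by
  apply Subset.antisymm
  · refine fun f hf ↦ ⟨⟨fun x ↦ (hf.1.1 x x).2 rfl, hf.1.2⟩, mem_iInter.2 fun i ↦ ?_⟩
    exact AM_subset_uniformlyControls (isCompact_compactCovering X i.1) Nat.one_div_pos_of_nat hf
  · rintro f ⟨⟨hzero, hsymm, htri⟩, hU⟩
    have key (x : X) {ε : ℝ} (hε : 0 < ε) : ∃ δ > 0, ∀ y, f (x, y) < δ → dist x y < ε := by
      obtain ⟨n, hn⟩ := exists_mem_compactCovering x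
      obtain ⟨m, hm⟩ := exists_nat_one_div_lt hε
      obtain ⟨δ, hδ, h⟩ := mem_iInter.1 hU (n, m)
      exact ⟨δ, hδ, fun y hy ↦ (h x hn y hy).trans hm⟩
    refine ⟨⟨fun x y ↦ ⟨fun h ↦ ?_, fun h ↦ h ▸ hzero x⟩, hsymm, htri⟩, fun s ↦ ⟨?_, ?_⟩⟩
    · refine dist_le_zero.1 (le_of_forall_pos_lt_add fun ε hε ↦ ?_)
      obtain ⟨δ, hδ, hd⟩ := key x hε
      simpa using hd y (h ▸ hδ)
    · intro hs x hx
      obtain ⟨ε, hε, hball⟩ := Metric.isOpen_iff.1 hs x hx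
      obtain ⟨δ, hδ, hd⟩ := key x hε
      exact ⟨δ, hδ, fun y hy ↦ hball (Metric.mem_ball'.2 (hd y hy))⟩
    · refine fun h ↦ isOpen_iff_mem_nhds.2 fun x hx ↦ ?_
      obtain ⟨ε, hε, hs⟩ := h x hx
      have hc : Continuous fun z ↦ f (x, z) := by fun_prop
      have hlt : ∀ᶠ z in 𝓝 x, f (x, z) < ε :=
        hc.continuousAt.eventually_lt continuousAt_const (by rwa [hzero x])
      exact hlt.mono hs

/-- If `X` is σ-compact metrizable, then `AM(X)` with the sup-metric is
completely metrizable. -/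
theorem completelyMetrizable_AM_of_sigmaCompact (X : Type*) [TopologicalSpace X]
    [TopologicalSpace.MetrizableSpace X] [SigmaCompactSpace X] :
    CompletelyMetrizable ↥(AM X) := by
  let := TopologicalSpace.metrizableSpaceMetric X
  have h : TopologicalSpace.IsCompletelyMetrizableSpace ↥(AM X) := by
    rw [AM_eq_inter]
    exact isCompletelyMetrizableSpace_inter_iInter (isClosed_pseudometricFuns X)
      fun _ ↦ isOpen_uniformlyControls _ _
  exact h.complete
end

section
/- Let X be a metrizable space. If the space AM(X) of bounded admissible metrics on X, endowed with the sup-metric, is completely metrizable, then X is σ-locally compact, i.e., X can be written as a countable union of closed subsets each of which is locally compact in its subspace topology. -/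
open Set Filter Topology UniformConvergence

/-- A topological space is σ-locally compact if it is a countable union of closed
locally compact subspaces. -/
def SigmaLocallyCompact (Z : Type*) [TopologicalSpace Z] : Prop :=
  ∃ F : ℕ → Set Z, (∀ n, IsClosed (F n)) ∧ (∀ n, LocallyCompactSpace (F n)) ∧
    (⋃ n, F n) = Set.univ

open scoped BoundedContinuousFunction

section Topology

variable {X : Type*} [TopologicalSpace X]

/-- Every point of the space has a neighbourhood meeting `A` in a compact set. For closed `A` this
says that `A` is locally compact. -/
def HasCompactTraces (A : Set X) : Prop := ∀ y : X, ∃ N ∈ 𝓝 y, IsCompact (N ∩ A)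

/-- `A` is covered by countably many closed sets with compact traces. -/
def SigmaCovered (A : Set X) : Prop :=
  ∃ F : ℕ → Set X, (∀ n, IsClosed (F n)) ∧ (∀ n, HasCompactTraces (F n)) ∧ A ⊆ ⋃ n, F n

lemma IsCompact.hasCompactTraces {A : Set X} (hA : IsCompact A) : HasCompactTraces A :=
  fun _ => ⟨univ, univ_mem, by simpa using hA⟩

lemma HasCompactTraces.locallyCompactSpace [T2Space X] {A : Set X} (hA : HasCompactTraces A) :
    LocallyCompactSpace A := by
  have : WeaklyLocallyCompactSpace A := by
    refine ⟨fun x => ?_⟩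
    obtain ⟨N, hN, hc⟩ := hA x
    refine ⟨Subtype.val ⁻¹' N, ?_, continuous_subtype_val.continuousAt hN⟩
    rw [Subtype.isCompact_iff, Subtype.image_preimage_coe, inter_comm]
    exact hc
  infer_instance

lemma SigmaCovered.mono {A B : Set X} (hB : SigmaCovered B) (h : A ⊆ B) : SigmaCovered A := by
  obtain ⟨F, h1, h2, h3⟩ := hB
  exact ⟨F, h1, h2, h.trans h3⟩

lemma IsCompact.sigmaCovered [T2Space X] {A : Set X} (hA : IsCompact A) : SigmaCovered A :=
  ⟨fun _ => A, fun _ => hA.isClosed, fun _ => hA.hasCompactTraces, by simp [iUnion_const]⟩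

lemma sigmaCovered_iUnion {A : ℕ → Set X} (hA : ∀ n, SigmaCovered (A n)) :
    SigmaCovered (⋃ n, A n) := by
  choose F h1 h2 h3 using hA
  refine ⟨fun k => F k.unpair.1 k.unpair.2, fun k => h1 _ _, fun k => h2 _ _, ?_⟩
  refine iUnion_subset fun n x hx => ?_
  obtain ⟨m, hm⟩ := mem_iUnion.1 (h3 n hx)
  exact mem_iUnion.2 ⟨Nat.pair n m, by simpa using hm⟩

lemma SigmaCovered.union {A B : Set X} (hA : SigmaCovered A) (hB : SigmaCovered B) :
    SigmaCovered (A ∪ B) := by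
  refine (sigmaCovered_iUnion (A := fun n => if n = 0 then A else B) fun n => ?_).mono ?_
  · split_ifs <;> assumption
  · exact union_subset (subset_iUnion_of_subset 0 (by simp)) (subset_iUnion_of_subset 1 (by simp))

lemma LocallyFinite.hasCompactTraces_iUnion [RegularSpace X] {ι : Type*} {A : ι → Set X}
    (hf : LocallyFinite A) (hA : ∀ i, HasCompactTraces (A i)) : HasCompactTraces (⋃ i, A i) := by
  intro y
  obtain ⟨M, hM, hfin⟩ := hf y
  choose N hN hc using fun i => hA i y
  have hmem : M ∩ ⋂ i ∈ {i | (A i ∩ M).Nonempty}, N i ∈ 𝓝 y :=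
    inter_mem hM ((biInter_mem hfin).2 fun i _ => hN i)
  obtain ⟨C, hC, hCc, hCs⟩ := exists_mem_nhds_isClosed_subset hmem
  refine ⟨C, hC, ?_⟩
  have : C ∩ ⋃ i, A i = ⋃ i ∈ {i | (A i ∩ M).Nonempty}, C ∩ (N i ∩ A i) := by
    ext z
    simp only [mem_inter_iff, mem_iUnion, mem_ofPred_eq, exists_prop]
    constructor
    · rintro ⟨hz, i, hi⟩
      have hne : (A i ∩ M).Nonempty := ⟨z, hi, (hCs hz).1⟩
      exact ⟨i, hne, hz, mem_iInter₂.1 (hCs hz).2 i hne, hi⟩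
    · rintro ⟨i, -, hz, -, hi⟩
      exact ⟨hz, i, hi⟩
  rw [this]
  exact hfin.isCompact_biUnion fun i _ => (hc i).inter_left hCc

lemma HasCompactTraces.inter_isClosed {A C : Set X} (hA : HasCompactTraces A) (hC : IsClosed C) :
    HasCompactTraces (C ∩ A) := by
  intro y
  obtain ⟨N, hN, hc⟩ := hA y
  refine ⟨N, hN, ?_⟩
  rw [inter_left_comm]
  exact hc.inter_left hC

/-- A closed set that is locally `SigmaCovered` is `SigmaCovered`. -/
lemma sigmaCovered_of_locally [T2Space X] [ParacompactSpace X] {C : Set X} (hC : IsClosed C)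
    (h : ∀ x ∈ C, ∃ V, IsOpen V ∧ x ∈ V ∧ SigmaCovered (V ∩ C)) : SigmaCovered C := by
  have h' : ∀ x, ∃ V, IsOpen V ∧ x ∈ V ∧ SigmaCovered (V ∩ C) := by
    intro x
    by_cases hx : x ∈ C
    · exact h x hx
    · exact ⟨Cᶜ, hC.isOpen_compl, hx, by simpa using (isCompact_empty (X := X)).sigmaCovered⟩
  choose V hVo hxV hV using h'
  choose F hFc hFt hF using hV
  obtain ⟨u, huo, huU, hulf, huV⟩ := precise_refinement V hVo
    (eq_univ_of_forall fun x => mem_iUnion.2 ⟨x, hxV x⟩)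
  obtain ⟨w, hwU, hwc, hwu⟩ := exists_iUnion_eq_closed_subset huo hulf.point_finite huU
  have hlf : ∀ n, LocallyFinite fun x => w x ∩ F x n := fun n =>
    hulf.subset fun x => inter_subset_left.trans (hwu x)
  refine ⟨fun n => ⋃ x, w x ∩ F x n, fun n => (hlf n).isClosed_iUnion fun x =>
    (hwc x).inter (hFc x n), fun n => (hlf n).hasCompactTraces_iUnion fun x =>
    (hFt x n).inter_isClosed (hwc x), fun z hz => ?_⟩
  obtain ⟨x, hx⟩ := mem_iUnion.1 (hwU.ge (mem_univ z))
  obtain ⟨n, hn⟩ := mem_iUnion.1 (hF x ⟨huV x (hwu x hx), hz⟩)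
  exact mem_iUnion.2 ⟨n, mem_iUnion.2 ⟨x, hx, hn⟩⟩

/-- A closed set which is not `SigmaCovered` contains a nonempty closed set which is nowhere
locally compact. -/
lemma exists_nowhere_locally_compact [TopologicalSpace.MetrizableSpace X] {F : Set X}
    (hF : IsClosed F) (hn : ¬ SigmaCovered F) :
    ∃ K ⊆ F, IsClosed K ∧ K.Nonempty ∧ ∀ x ∈ K, ∀ N ∈ 𝓝 x, ¬ IsCompact (N ∩ K) := by
  let _ := TopologicalSpace.metrizableSpaceMetric X
  set U : Set X := ⋃₀ {V | IsOpen V ∧ SigmaCovered (V ∩ F)} with hU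
  have hUo : IsOpen U := isOpen_sUnion fun V hV => hV.1
  have hUF : SigmaCovered (U ∩ F) := by
    obtain ⟨C, hCc, hCU, hC, -⟩ := hUo.exists_iUnion_isClosed
    rw [← hC, iUnion_inter]
    refine sigmaCovered_iUnion fun n => sigmaCovered_of_locally ((hCc n).inter hF) ?_
    rintro x ⟨hx, -⟩
    obtain ⟨V, ⟨hVo, hV⟩, hxV⟩ := hCU n hx
    exact ⟨V, hVo, hxV, hV.mono (inter_subset_inter_right _ inter_subset_right)⟩
  have key : ∀ V, IsOpen V → SigmaCovered (V ∩ (F \ U)) → V ⊆ U := by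
    intro V hVo hV
    refine subset_sUnion_of_mem ⟨hVo, (hUF.union hV).mono ?_⟩
    rintro z ⟨hz, hzF⟩
    by_cases hzU : z ∈ U
    · exact Or.inl ⟨hzU, hzF⟩
    · exact Or.inr ⟨hz, hzF, hzU⟩
  refine ⟨F \ U, sdiff_subset, hF.sdiff hUo, ?_, ?_⟩
  · rw [nonempty_iff_ne_empty]
    intro he
    refine hn (hUF.mono fun z hz => ⟨?_, hz⟩)
    exact sdiff_eq_empty.1 he hz
  · intro x hx N hN hc
    refine hx.2 (key _ isOpen_interior (hc.sigmaCovered.mono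
      (inter_subset_inter_left _ interior_subset)) (mem_interior_iff_mem_nhds.2 hN))

lemma SigmaCovered.sigmaLocallyCompact [T2Space X] (h : SigmaCovered (univ : Set X)) :
    SigmaLocallyCompact X := by
  obtain ⟨F, h1, h2, h3⟩ := h
  exact ⟨F, h1, fun n => (h2 n).locallyCompactSpace, univ_subset_iff.1 h3⟩

/-- A noncompact closed set contains a sequence without cluster points. -/
lemma exists_seq_not_mapClusterPt [TopologicalSpace.MetrizableSpace X] {A : Set X}
    (hA : IsClosed A) (hc : ¬ IsCompact A) :
    ∃ s : ℕ → X, (∀ k, s k ∈ A) ∧ ∀ a, ¬ MapClusterPt a atTop s := by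
  let _ := TopologicalSpace.metrizableSpaceMetric X
  by_contra! h
  refine hc (isCompact_iff_isSeqCompact.2 fun s hs => ?_)
  obtain ⟨a, ha⟩ := h s hs
  obtain ⟨φ, hφ, hlim⟩ := ha.tendsto_subseq
  exact ⟨a, hA.mem_of_tendsto hlim (Eventually.of_forall fun k => hs _), φ, hφ, hlim⟩

/-- A completely metrizable subspace `A` of a metric space is a `Gδ`: its relative complement in
its closure is contained in the union of countably many closed sets disjoint from `A`. -/
lemma CompletelyMetrizable.exists_closed_cover [T2Space X] {A : Set X}
    (h : CompletelyMetrizable A) :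
    ∃ E : ℕ → Set X, (∀ n, IsClosed (E n)) ∧ (∀ n, Disjoint (E n) A) ∧
      closure A \ A ⊆ ⋃ n, E n := by
  obtain ⟨m, hm, hcomp⟩ := h
  let O : ℕ → Set X := fun n => ⋃₀ {V | IsOpen V ∧
    ∀ a b : A, (a : X) ∈ V → (b : X) ∈ V → m.dist a b < 1 / (n + 1)}
  have hO : ∀ n, IsOpen (O n) := fun n => isOpen_sUnion fun V hV => hV.1
  refine ⟨fun n => (O n)ᶜ, fun n => (hO n).isClosed_compl, fun n => ?_, ?_⟩
  · rw [disjoint_compl_left_iff_subset]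
    intro x hx
    have hopen : IsOpen[m.toPseudoMetricSpace.toUniformSpace.toTopologicalSpace]
        (@Metric.ball A m.toPseudoMetricSpace ⟨x, hx⟩ (1 / (n + 1) / 2)) :=
      @Metric.isOpen_ball A m.toPseudoMetricSpace _ _
    rw [hm, isOpen_induced_iff] at hopen
    obtain ⟨V, hV, hVb⟩ := hopen
    have hsub : ∀ a : A, (a : X) ∈ V → m.dist a ⟨x, hx⟩ < 1 / (n + 1) / 2 := by
      intro a ha
      have : a ∈ Subtype.val ⁻¹' V := ha
      rwa [hVb] at this
    refine ⟨V, ⟨hV, fun a b ha hb => ?_⟩, ?_⟩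
    · have h1 := m.dist_triangle a ⟨x, hx⟩ b
      have h2 := hsub a ha
      have h3 := hsub b hb
      rw [m.dist_comm] at h3
      linarith
    · have : (⟨x, hx⟩ : A) ∈ Subtype.val ⁻¹' V := by
        rw [hVb]
        exact @Metric.mem_ball_self A m.toPseudoMetricSpace _ _ (by positivity)
      exact this
  · rintro x ⟨hxc, hxA⟩
    by_contra hx
    simp only [mem_iUnion, mem_compl_iff, not_exists, not_not] at hx
    let _ := m
    let l : Filter A := comap Subtype.val (𝓝 x)
    have hne : l.NeBot := mem_closure_iff_comap_neBot.1 hxc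
    have hl : Cauchy l := by
      rw [Metric.cauchy_iff]
      refine ⟨hne, fun ε hε => ?_⟩
      obtain ⟨n, hn⟩ := exists_nat_one_div_lt hε
      obtain ⟨V, ⟨hV, hVd⟩, hxV⟩ := hx n
      exact ⟨_, preimage_mem_comap (hV.mem_nhds hxV), fun a ha b hb =>
        (hVd a b ha hb).trans hn⟩
    obtain ⟨a, ha⟩ := CompleteSpace.complete hl
    have hlim : Tendsto (Subtype.val : A → X) l (𝓝 (a : X)) := by
      have : l ≤ @nhds A instTopologicalSpaceSubtype a := by
        rw [← hm]
        exact ha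
      exact (continuous_subtype_val.tendsto a).mono_left this
    have : (a : X) = x := tendsto_nhds_unique hlim tendsto_comap
    exact hxA (this ▸ a.2)

end Topology

section Metrics

variable {X : Type*}

lemma IsMetricFun.nonneg {d : X × X → ℝ} (hd : IsMetricFun d) (x y : X) : 0 ≤ d (x, y) := by
  have h1 := hd.2.2 x y x
  rw [(hd.1 x x).2 rfl, hd.2.1 y x] at h1
  linarith

lemma IsMetricFun.self {d : X × X → ℝ} (hd : IsMetricFun d) (x : X) : d (x, x) = 0 :=
  (hd.1 x x).2 rfl

/-- If a positive function `v` is the distance to an ideal point, passing through the ideal point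
does not change the topology. -/
lemma isMetricFun_min {d : X × X → ℝ} (hd : IsMetricFun d) {v : X → ℝ} (hv : ∀ a, 0 < v a)
    (hl : ∀ a b, v a ≤ d (a, b) + v b) :
    IsMetricFun fun p : X × X => min (d p) (v p.1 + v p.2) := by
  refine ⟨fun x y => ?_, fun x y => ?_, fun x y z => ?_⟩
  · rw [← hd.1 x y]
    have h1 := hd.nonneg x y
    have h2 := hv x
    have h3 := hv y
    constructor
    · intro h
      rcases min_choice (d (x, y)) (v x + v y) with h4 | h4
      · exact h4.symm.trans h
      · have := h4.symm.trans h
        linarith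
    · intro h
      exact (min_eq_left (by dsimp only; linarith)).trans h
  · dsimp only
    rw [hd.2.1 x y, add_comm]
  · have h1 := hd.2.2 x y z
    have h2 := hl x y
    have h3 := hl z y
    rw [hd.2.1 z y] at h3
    have h4 := hv y
    dsimp only
    rcases min_choice (d (x, y)) (v x + v y) with h | h <;>
    rcases min_choice (d (y, z)) (v y + v z) with h' | h' <;> rw [h, h']
    · exact (min_le_left _ _).trans h1
    · exact (min_le_right _ _).trans (by linarith)
    · exact (min_le_right _ _).trans (by linarith)
    · exact (min_le_right _ _).trans (by linarith)

variable [TopologicalSpace X]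

lemma inducesTopology_min {d : X × X → ℝ} (ht : InducesTopology d) {v : X → ℝ}
    (hv : ∀ a, 0 < v a) :
    InducesTopology fun p : X × X => min (d p) (v p.1 + v p.2) := by
  intro s
  rw [ht s]
  refine forall₂_congr fun x _ => ⟨?_, ?_⟩
  · rintro ⟨ε, hε, h⟩
    refine ⟨min ε (v x), lt_min hε (hv x), fun y hy => h y ?_⟩
    rcases min_lt_iff.1 hy with h1 | h1
    · exact h1.trans_le (min_le_left _ _)
    · have := h1.trans_le (min_le_right _ _)
      have := hv y
      dsimp only at *
      linarith
  · rintro ⟨ε, hε, h⟩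
    exact ⟨ε, hε, fun y hy => h y ((min_le_left _ _).trans_lt hy)⟩

/-- The function `(a, b) ↦ min (f (a, b)) (v a + v b)`. -/
def glue (f : X × X →ᵇ ℝ) (v : X →ᵇ ℝ) : X × X →ᵇ ℝ :=
  f ⊓ (v.compContinuous ⟨Prod.fst, continuous_fst⟩ + v.compContinuous ⟨Prod.snd, continuous_snd⟩)

lemma glue_apply (f : X × X →ᵇ ℝ) (v : X →ᵇ ℝ) (p : X × X) :
    glue f v p = min (f p) (v p.1 + v p.2) := rfl

lemma continuous_glue : Continuous fun q : (X × X →ᵇ ℝ) × (X →ᵇ ℝ) => glue q.1 q.2 := by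
  unfold glue
  exact continuous_fst.inf
    (((BoundedContinuousFunction.continuous_compContinuous _).comp continuous_snd).add
      ((BoundedContinuousFunction.continuous_compContinuous _).comp continuous_snd))

lemma glue_mem_AM {f : X × X →ᵇ ℝ} (hf : f ∈ AM X) {v : X →ᵇ ℝ} (hv : ∀ a, 0 < v a)
    (hl : ∀ a b, v a ≤ f (a, b) + v b) : glue f v ∈ AM X :=
  ⟨isMetricFun_min hf.1 hv hl, inducesTopology_min hf.2 hv⟩

lemma glue_mem_closure_AM {f : X × X →ᵇ ℝ} (hf : f ∈ AM X) {v : X →ᵇ ℝ} (hv : ∀ a, 0 ≤ v a)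
    (hl : ∀ a b, v a ≤ f (a, b) + v b) : glue f v ∈ closure (AM X) := by
  have hc : Continuous fun t : ℝ => glue f (v + BoundedContinuousFunction.const X t) := by
    have : Continuous fun t : ℝ => BoundedContinuousFunction.const X t := by
      refine continuous_iff_continuousAt.2 fun t => ?_
      rw [ContinuousAt, tendsto_iff_dist_tendsto_zero]
      refine squeeze_zero (fun _ => dist_nonneg) (fun s => ?_)
        (tendsto_iff_dist_tendsto_zero.1 (tendsto_id (x := 𝓝 t)))
      exact (BoundedContinuousFunction.dist_le dist_nonneg).2 fun x => le_rfl
    exact continuous_glue.comp (continuous_const.prodMk (continuous_const.add this))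
  have hlim : Tendsto (fun t : ℝ => glue f (v + BoundedContinuousFunction.const X t)) (𝓝[>] 0)
      (𝓝 (glue f v)) := by
    have := (hc.tendsto 0).mono_left (nhdsWithin_le_nhds (s := Ioi 0))
    convert this using 3
    ext x
    simp
  refine mem_closure_of_tendsto hlim ?_
  filter_upwards [self_mem_nhdsWithin] with t ht
  refine glue_mem_AM hf (fun a => ?_) fun a b => ?_
  · exact add_pos_of_nonneg_of_pos (hv a) ht
  · have := add_le_add_left (hl a b) t
    rwa [add_assoc] at this

lemma apply_mem_nhds {f : X × X →ᵇ ℝ} (hf : f ∈ AM X) (x : X) {ε : ℝ} (hε : 0 < ε) :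
    {y | f (x, y) < ε} ∈ 𝓝 x := by
  have hc : Continuous fun y => f (x, y) := by fun_prop
  have := hf.1.self x
  exact hc.continuousAt.eventually_lt continuousAt_const (by simpa [this] using hε)

lemma exists_apply_lt_mem {f : X × X →ᵇ ℝ} (hf : f ∈ AM X) {x : X} {U : Set X} (hU : U ∈ 𝓝 x) :
    ∃ ε > 0, ∀ y, f (x, y) < ε → y ∈ U := by
  obtain ⟨V, hVU, hVo, hxV⟩ := mem_nhds_iff.1 hU
  obtain ⟨ε, hε, h⟩ := (hf.2 V).1 hVo x hxV
  exact ⟨ε, hε, fun y hy => hVU (h y hy)⟩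

lemma tendsto_of_apply {f : X × X →ᵇ ℝ} (hf : f ∈ AM X) {a : X} {y : ℕ → X}
    (h : Tendsto (fun k => f (a, y k)) atTop (𝓝 0)) : Tendsto y atTop (𝓝 a) := by
  refine tendsto_def.2 fun U hU => ?_
  obtain ⟨ε, hε, hεU⟩ := exists_apply_lt_mem hf hU
  filter_upwards [h.eventually_lt_const hε] with k hk using hεU _ hk

/-- The distance to a point. -/
def distTo (f : X × X →ᵇ ℝ) (x : X) : X →ᵇ ℝ :=
  f.compContinuous ⟨fun a => (a, x), by fun_prop⟩

lemma distTo_apply (f : X × X →ᵇ ℝ) (x a : X) : distTo f x a = f (a, x) := rfl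

lemma dist_distTo_le {f : X × X →ᵇ ℝ} (hf : f ∈ AM X) (x y : X) :
    dist (distTo f x) (distTo f y) ≤ f (x, y) := by
  refine (BoundedContinuousFunction.dist_le (hf.1.nonneg x y)).2 fun a => ?_
  rw [distTo_apply, distTo_apply, Real.dist_eq, abs_le]
  have h1 := hf.1.2.2 a x y
  have h2 := hf.1.2.2 a y x
  rw [hf.1.2.1 y x] at h2
  constructor <;> linarith

lemma dist_distTo_distTo_le (f g : X × X →ᵇ ℝ) (x : X) :
    dist (distTo f x) (distTo g x) ≤ dist f g :=
  (BoundedContinuousFunction.dist_le dist_nonneg).2 fun a =>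
    BoundedContinuousFunction.dist_coe_le_dist (a, x)

lemma continuous_distTo : Continuous fun q : X × AM X => distTo (q.2 : X × X →ᵇ ℝ) q.1 := by
  rw [continuous_iff_continuousAt]
  rintro ⟨x, f, hf⟩
  rw [ContinuousAt, tendsto_iff_dist_tendsto_zero]
  have hc : Continuous fun q : X × AM X => dist (q.2 : X × X →ᵇ ℝ) f + f (q.1, x) :=
    ((continuous_subtype_val.comp continuous_snd).dist continuous_const).add
      (f.continuous.comp (continuous_fst.prodMk continuous_const))
  have h0 := hc.tendsto (x, ⟨f, hf⟩)
  rw [dist_self, hf.1.self, add_zero] at h0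
  refine squeeze_zero (fun _ => dist_nonneg) (fun q => ?_) h0
  exact (dist_triangle _ (distTo f q.1) _).trans
    (add_le_add (dist_distTo_distTo_le _ _ _) (dist_distTo_le hf _ _))

/-- The infimum of the distances to the points `s k`, penalized by `1 / (k + 1)`. -/
noncomputable def penalizedFun (f : X × X →ᵇ ℝ) (s : ℕ → X) (a : X) : ℝ :=
  ⨅ k : ℕ, (f (a, s k) + 1 / ((k : ℝ) + 1))

lemma penalizedFun_le {f : X × X →ᵇ ℝ} (hf : f ∈ AM X) (s : ℕ → X) (a : X) (k : ℕ) :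
    penalizedFun f s a ≤ f (a, s k) + 1 / ((k : ℝ) + 1) :=
  ciInf_le ⟨0, by
    rintro _ ⟨k, rfl⟩
    exact add_nonneg (hf.1.nonneg _ _) (by positivity)⟩ k

lemma penalizedFun_nonneg {f : X × X →ᵇ ℝ} (hf : f ∈ AM X) (s : ℕ → X) (a : X) :
    0 ≤ penalizedFun f s a :=
  le_ciInf fun k => add_nonneg (hf.1.nonneg _ _) (by positivity)

lemma penalizedFun_apply_le {f : X × X →ᵇ ℝ} (hf : f ∈ AM X) (s : ℕ → X) (k : ℕ) :
    penalizedFun f s (s k) ≤ 1 / ((k : ℝ) + 1) := by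
  simpa [hf.1.self] using penalizedFun_le hf s (s k) k

lemma penalizedFun_lipschitz {f : X × X →ᵇ ℝ} (hf : f ∈ AM X) (s : ℕ → X) (a b : X) :
    penalizedFun f s a ≤ f (a, b) + penalizedFun f s b := by
  rw [← sub_le_iff_le_add']
  refine le_ciInf fun k => ?_
  have h1 := penalizedFun_le hf s a k
  have h2 := hf.1.2.2 a b (s k)
  linarith

lemma penalizedFun_pos {f : X × X →ᵇ ℝ} (hf : f ∈ AM X) (s : ℕ → X)
    (hs : ∀ a, ¬ MapClusterPt a atTop s) (a : X) :
    0 < penalizedFun f s a := by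
  have h := hs a
  simp only [mapClusterPt_iff_frequently, not_forall, not_frequently] at h
  obtain ⟨U, hU, hsU⟩ := h
  obtain ⟨ε, hε, h⟩ := exists_apply_lt_mem hf hU
  obtain ⟨n, hn⟩ := eventually_atTop.1 hsU
  refine lt_of_lt_of_le (lt_min hε (show (0 : ℝ) < 1 / ((n : ℝ) + 1) by positivity))
    (le_ciInf fun k => ?_)
  have h0 := hf.1.nonneg a (s k)
  rcases le_total n k with hk | hk
  · refine (min_le_left _ _).trans ?_
    have h1 : ε ≤ f (a, s k) := not_lt.1 fun h2 => hn k hk (h _ h2)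
    have h2 : 0 ≤ 1 / ((k : ℝ) + 1) := by positivity
    linarith
  · refine (min_le_right _ _).trans ?_
    have h1 : 1 / ((n : ℝ) + 1) ≤ 1 / ((k : ℝ) + 1) := by gcongr
    linarith

lemma continuous_of_lipschitz {f : X × X →ᵇ ℝ} (hf : f ∈ AM X) {v : X → ℝ}
    (hl : ∀ a b, v a ≤ f (a, b) + v b) :
    Continuous v := by
  refine continuous_iff_continuousAt.2 fun a => Metric.tendsto_nhds.2 fun ε hε => ?_
  filter_upwards [apply_mem_nhds hf a hε] with b hb
  have h1 := hl a b
  have h2 := hl b a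
  have hb : f (a, b) < ε := hb
  rw [hf.1.2.1 b a] at h2
  rw [Real.dist_eq, abs_lt]
  constructor <;> linarith

/-- `penalizedFun` as a bounded continuous function. -/
noncomputable def penalized (s : ℕ → X) (f : AM X) : X →ᵇ ℝ :=
  BoundedContinuousFunction.ofNormedAddCommGroup (penalizedFun f s)
    (continuous_of_lipschitz f.2 (penalizedFun_lipschitz f.2 s)) (‖(f : X × X →ᵇ ℝ)‖ + 1) <| by
    intro a
    rw [Real.norm_of_nonneg (penalizedFun_nonneg f.2 s a)]
    refine (penalizedFun_le f.2 s a 0).trans ?_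
    have := (le_abs_self _).trans ((f : X × X →ᵇ ℝ).norm_coe_le_norm (a, s 0))
    simpa using this

lemma penalized_apply (s : ℕ → X) (f : AM X) (a : X) :
    penalized s f a = penalizedFun f s a := rfl

lemma continuous_penalized (s : ℕ → X) : Continuous (penalized s) := by
  have key : ∀ (f g : AM X) (a : X), penalizedFun f s a ≤ penalizedFun g s a + dist f g := by
    intro f g a
    rw [← sub_le_iff_le_add]
    refine le_ciInf fun k => ?_
    have h1 := penalizedFun_le f.2 s a k
    have h2 := (le_abs_self _).trans
      (BoundedContinuousFunction.dist_coe_le_dist (f := (f : X × X →ᵇ ℝ)) (g := g) (a, s k))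
    rw [Subtype.dist_eq]
    linarith
  refine (LipschitzWith.of_dist_le_mul (K := 1) fun f g => ?_).continuous
  rw [NNReal.coe_one, one_mul]
  refine (BoundedContinuousFunction.dist_le dist_nonneg).2 fun a => ?_
  rw [penalized_apply, penalized_apply, Real.dist_eq, abs_le]
  have h1 := key f g a
  have h2 := key g f a
  rw [dist_comm g f] at h2
  constructor <;> linarith

/-- The pseudometric obtained from `f` by identifying `x` with an ideal limit of `s`. -/
noncomputable def collapse (s : ℕ → X) (q : X × AM X) : X × X →ᵇ ℝ :=
  glue q.2 (distTo q.2 q.1 ⊓ penalized s q.2)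

lemma continuous_collapse (s : ℕ → X) : Continuous (collapse s) :=
  continuous_glue.comp ((continuous_subtype_val.comp continuous_snd).prodMk
    (continuous_distTo.inf ((continuous_penalized s).comp continuous_snd)))

lemma min_le_add_min {a b c d e : ℝ} (h1 : a ≤ e + b) (h2 : c ≤ e + d) :
    min a c ≤ e + min b d := by
  rw [← min_add_add_left]
  exact min_le_min h1 h2

lemma distTo_lipschitz {f : X × X →ᵇ ℝ} (hf : f ∈ AM X) (x a b : X) :
    distTo f x a ≤ f (a, b) + distTo f x b := hf.1.2.2 a b x

lemma collapse_mem_closure (s : ℕ → X) (q : X × AM X) : collapse s q ∈ closure (AM X) :=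
  glue_mem_closure_AM q.2.2
    (fun a => le_min (q.2.2.1.nonneg a q.1) (penalizedFun_nonneg q.2.2 s a))
    fun a b => min_le_add_min (distTo_lipschitz q.2.2 _ a b) (penalizedFun_lipschitz q.2.2 s a b)

lemma collapse_notMem {s : ℕ → X} (hs : ∀ a, ¬ MapClusterPt a atTop s) (q : X × AM X) :
    collapse s q ∉ AM X := by
  intro h
  refine hs q.1 (Tendsto.mapClusterPt (tendsto_of_apply h ?_))
  refine squeeze_zero (fun k => h.1.nonneg _ _) (fun k => ?_)
    tendsto_one_div_add_atTop_nhds_zero_nat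
  refine (min_le_right _ _).trans ?_
  have h1 : (distTo q.2.1 q.1 ⊓ penalized s q.2) q.1 ≤ 0 :=
    (min_le_left _ _).trans (q.2.2.1.self q.1).le
  have h2 : (distTo q.2.1 q.1 ⊓ penalized s q.2) (s k) ≤ 1 / ((k : ℝ) + 1) :=
    (min_le_right _ _).trans (penalizedFun_apply_le q.2.2 s k)
  exact (add_le_add h1 h2).trans (zero_add _).le

/-- Collapsing along a Cauchy sequence without limit yields an admissible metric in the limit. -/
lemma exists_tendsto_collapse {s : ℕ → X} (hs : ∀ a, ¬ MapClusterPt a atTop s) (f : AM X)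
    {y : ℕ → X} (hy : ∀ a, ¬ Tendsto y atTop (𝓝 a))
    (hc : ∀ ε > 0, ∃ N, ∀ m ≥ N, ∀ n ≥ N, (f : X × X →ᵇ ℝ) (y m, y n) < ε) :
    ∃ h ∈ AM X, Tendsto (fun k => collapse s (y k, f)) atTop (𝓝 h) := by
  have hC : CauchySeq fun k => distTo (f : X × X →ᵇ ℝ) (y k) := by
    refine Metric.cauchySeq_iff.2 fun ε hε => ?_
    obtain ⟨N, hN⟩ := hc ε hε
    exact ⟨N, fun m hm n hn => (dist_distTo_le f.2 _ _).trans_lt (hN m hm n hn)⟩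
  obtain ⟨V, hV⟩ := cauchySeq_tendsto_of_complete hC
  have hpt : ∀ a, Tendsto (fun k => (f : X × X →ᵇ ℝ) (a, y k)) atTop (𝓝 (V a)) := fun a =>
    ((continuous_eval_const a).tendsto V).comp hV
  have hV0 : ∀ a, 0 < V a := by
    intro a
    refine lt_of_le_of_ne (ge_of_tendsto' (hpt a) fun k => f.2.1.nonneg _ _) fun h0 => ?_
    exact hy a (tendsto_of_apply f.2 (h0 ▸ hpt a))
  have hVl : ∀ a b, V a ≤ (f : X × X →ᵇ ℝ) (a, b) + V b := fun a b =>
    le_of_tendsto_of_tendsto' (hpt a) ((hpt b).const_add _) fun k => f.2.1.2.2 _ _ _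
  refine ⟨glue f (V ⊓ penalized s f), glue_mem_AM f.2
    (fun a => lt_min (hV0 a) (penalizedFun_pos f.2 s hs a))
    (fun a b => min_le_add_min (hVl a b) (penalizedFun_lipschitz f.2 s a b)), ?_⟩
  exact (continuous_glue.tendsto (_, _)).comp
    (tendsto_const_nhds.prodMk_nhds (hV.inf_nhds tendsto_const_nhds))

/-- An admissible metric can be approximated by one for which a given sequence without cluster
points, contained in a small ball, is Cauchy. -/
lemma exists_close_cauchy (f : AM X) {x : X} {y : ℕ → X} {δ : ℝ}
    (hδ : ∀ k, (f : X × X →ᵇ ℝ) (x, y k) ≤ δ) (hy : ∀ a, ¬ MapClusterPt a atTop y) :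
    ∃ g : AM X, dist g f ≤ 2 * δ ∧
      ∀ ε > 0, ∃ N, ∀ m ≥ N, ∀ n ≥ N, (g : X × X →ᵇ ℝ) (y m, y n) < ε := by
  have hδ0 : 0 ≤ δ := (f.2.1.nonneg _ _).trans (hδ 0)
  refine ⟨⟨glue f (penalized y f), glue_mem_AM f.2 (penalizedFun_pos f.2 y hy)
    (penalizedFun_lipschitz f.2 y)⟩, ?_, fun ε hε => ?_⟩
  · refine (BoundedContinuousFunction.dist_le (by positivity)).2 fun ⟨a, b⟩ => ?_
    have hlow : ∀ c, (f : X × X →ᵇ ℝ) (c, x) - δ ≤ penalized y f c := by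
      intro c
      refine le_ciInf fun k => ?_
      have h1 := f.2.1.2.2 c (y k) x
      have h2 := hδ k
      rw [f.2.1.2.1] at h2
      have h3 : 0 ≤ 1 / ((k : ℝ) + 1) := by positivity
      linarith
    have ha := hlow a
    have hb := hlow b
    have h1 := f.2.1.2.2 a x b
    rw [f.2.1.2.1 x b] at h1
    rw [glue_apply, Real.dist_eq, abs_le]
    refine ⟨?_, ?_⟩
    · rw [neg_le_sub_iff_le_add, ← sub_le_iff_le_add]
      refine le_min ?_ ?_
      · linarith
      · dsimp only
        linarith
    · have := min_le_left ((f : X × X →ᵇ ℝ) (a, b)) (penalized y f a + penalized y f b)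
      dsimp only
      linarith
  · obtain ⟨N, hN⟩ := exists_nat_one_div_lt (half_pos hε)
    have hb : ∀ n ≥ N, penalized y f (y n) < ε / 2 := fun n hn =>
      ((penalizedFun_apply_le f.2 y n).trans (by gcongr)).trans_lt hN
    refine ⟨N, fun m hm n hn => (min_le_right _ _).trans_lt ?_⟩
    have h1 := hb m hm
    have h2 := hb n hn
    change penalized y f (y m) + penalized y f (y n) < ε
    linarith

end Metrics

section MetricSpace

variable {X : Type*} [MetricSpace X]

lemma inducesTopology_dist : InducesTopology fun p : X × X => dist p.1 p.2 := by
  intro s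
  rw [Metric.isOpen_iff]
  refine forall₂_congr fun x _ => exists_congr fun ε => and_congr_right fun _ => ?_
  refine forall_congr' fun y => ?_
  rw [Metric.mem_ball, dist_comm]

lemma isMetricFun_dist : IsMetricFun fun p : X × X => dist p.1 p.2 :=
  ⟨fun _ _ => dist_eq_zero, dist_comm, dist_triangle⟩

/-- Truncating the distance at `1` gives a bounded admissible metric. -/
lemma exists_mem_AM_le_dist : ∃ f : AM X, ∀ x y : X, (f : X × X →ᵇ ℝ) (x, y) ≤ dist x y := by
  refine ⟨⟨BoundedContinuousFunction.ofNormedAddCommGroup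
    (fun p : X × X => min (dist p.1 p.2) (1 / 2 + 1 / 2)) (by fun_prop) 1 fun p => ?_, ?_, ?_⟩,
    fun x y => min_le_left _ _⟩
  · rw [Real.norm_of_nonneg (by positivity)]
    exact (min_le_right _ _).trans (by norm_num)
  · exact isMetricFun_min isMetricFun_dist (v := fun _ => 1 / 2) (fun _ => by norm_num)
      fun a b => le_add_of_nonneg_left dist_nonneg
  · exact inducesTopology_min inducesTopology_dist (v := fun _ => 1 / 2) (fun _ => by norm_num)

end MetricSpace

/-- If `X` is metrizable and `AM(X)` with the sup-metric is completely
metrizable, then `X` is σ-locally compact. -/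
theorem sigmaLocallyCompact_of_completelyMetrizable_AM (X : Type*) [TopologicalSpace X]
    [TopologicalSpace.MetrizableSpace X] (h : CompletelyMetrizable ↥(AM X)) :
    SigmaLocallyCompact X := by
  obtain ⟨E, hEc, hEd, hE⟩ := h.exists_closed_cover
  by_cases hX : IsCompact (univ : Set X)
  · exact hX.sigmaCovered.sigmaLocallyCompact
  obtain ⟨s, -, hs⟩ := exists_seq_not_mapClusterPt isClosed_univ hX
  have hcover : ∀ q : X × AM X, ∃ n, collapse s q ∈ E n := fun q =>
    mem_iUnion.1 (hE ⟨collapse_mem_closure s q, collapse_notMem hs q⟩)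
  have hlim : ∀ (f : AM X) (y : ℕ → X) (n : ℕ), (∀ a, ¬ Tendsto y atTop (𝓝 a)) →
      (∀ ε > 0, ∃ N, ∀ m ≥ N, ∀ n ≥ N, (f : X × X →ᵇ ℝ) (y m, y n) < ε) →
      ¬ ∀ k, collapse s (y k, f) ∈ E n := by
    intro f y n hy hc hk
    obtain ⟨h, hA, ht⟩ := exists_tendsto_collapse hs f hy hc
    exact disjoint_left.1 (hEd n) ((hEc n).mem_of_tendsto ht (Eventually.of_forall hk)) hA
  let _ := TopologicalSpace.metrizableSpaceMetric X
  obtain ⟨f₀, hf₀⟩ := exists_mem_AM_le_dist (X := X)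
  have hFc : ∀ n, IsClosed {x | collapse s (x, f₀) ∈ E n} := fun n =>
    (hEc n).preimage ((continuous_collapse s).comp (by fun_prop))
  refine SigmaCovered.sigmaLocallyCompact ((sigmaCovered_iUnion
    (A := fun n => {x | collapse s (x, f₀) ∈ E n}) fun n => ?_).mono
    fun x _ => mem_iUnion.2 (hcover (x, f₀)))
  by_contra hn
  obtain ⟨K, hKF, hKc, hKne, hK⟩ := exists_nowhere_locally_compact (hFc n) hn
  have hcomplete : CompleteSpace K := by
    refine Metric.complete_of_cauchySeq_tendsto fun u hu => ?_
    by_contra! hu'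
    refine hlim f₀ (fun k => (u k : X)) n (fun a ha => ?_) (fun ε hε => ?_) fun k => hKF (u k).2
    · have haK : a ∈ K := hKc.mem_of_tendsto ha (Eventually.of_forall fun k => (u k).2)
      exact hu' ⟨a, haK⟩ (tendsto_subtype_rng.2 ha)
    · obtain ⟨N, hN⟩ := Metric.cauchySeq_iff.1 hu ε hε
      exact ⟨N, fun m hm n hn => (hf₀ _ _).trans_lt (hN m hm n hn)⟩
  have : TopologicalSpace.IsCompletelyMetrizableSpace (AM X) := ⟨h⟩
  have : Nonempty K := hKne.to_subtype
  have : Nonempty (AM X) := ⟨f₀⟩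
  have hcont : Continuous fun q : K × AM X => collapse s (q.1, q.2) :=
    (continuous_collapse s).comp (by fun_prop)
  obtain ⟨i, ⟨x, f⟩, hi⟩ := nonempty_interior_of_iUnion_of_closed
    (fun i => (hEc i).preimage hcont)
    (eq_univ_of_forall fun q : K × AM X => mem_iUnion.2 (hcover (q.1, q.2)))
  rw [mem_interior_iff_mem_nhds, mem_nhds_prod_iff] at hi
  obtain ⟨U, hU, W, hW, hUW⟩ := hi
  obtain ⟨U', hU', hUU'⟩ := mem_nhds_subtype _ _ _ |>.1 hU
  obtain ⟨ε, hε, hεW⟩ := Metric.mem_nhds_iff.1 hW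
  obtain ⟨C, hC, hCc, hCs⟩ := exists_mem_nhds_isClosed_subset
    (inter_mem hU' (apply_mem_nhds f.2 (x : X) (show 0 < ε / 4 by positivity)))
  obtain ⟨y, hyC, hy⟩ := exists_seq_not_mapClusterPt (hCc.inter hKc) (hK x x.2 C hC)
  obtain ⟨g, hgf, hg⟩ := exists_close_cauchy f (fun k => (hCs (hyC k).1).2.le) hy
  refine hlim g y i (fun a ha => hy a ha.mapClusterPt) hg fun k => ?_
  have hmem : ((⟨y k, (hyC k).2⟩, g) : K × AM X) ∈ U ×ˢ W :=
    ⟨hUU' (hCs (hyC k).1).1, hεW (Metric.mem_ball.2 (by linarith))⟩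
  exact hUW hmem
end

section
/- Let X be a metrizable space. If the space AM(X) of bounded admissible metrics on X, endowed with the sup-metric, is σ-locally compact (a countable union of closed locally compact subspaces), then X is completely metrizable. -/
open Set Filter Topology UniformConvergence

open BoundedContinuousFunction

/-- The set of bounded continuous pseudometrics on `X`. -/
def boundedPseudometrics (X : Type*) [TopologicalSpace X] :
    Set (BoundedContinuousFunction (X × X) ℝ) :=
  {f | (∀ x, f (x, x) = 0) ∧ (∀ x y, f (x, y) = f (y, x)) ∧
    ∀ x y z, f (x, z) ≤ f (x, y) + f (y, z)}

lemma boundedPseudometrics_nonneg {X : Type*} [TopologicalSpace X]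
    {f : BoundedContinuousFunction (X × X) ℝ} (hf : f ∈ boundedPseudometrics X) (x y : X) :
    0 ≤ f (x, y) := by
  obtain ⟨h0, hs, ht⟩ := hf
  have h := ht x y x
  rw [h0, hs y x] at h
  linarith

lemma isClosed_boundedPseudometrics (X : Type*) [TopologicalSpace X] :
    IsClosed (boundedPseudometrics X) := by
  have hc (p : X × X) : Continuous fun f : BoundedContinuousFunction (X × X) ℝ => f p :=
    continuous_eval_const p
  simp only [boundedPseudometrics, ofPred_and, ofPred_forall]
  refine IsClosed.inter ?_ (IsClosed.inter ?_ ?_)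
  · exact isClosed_iInter fun x => isClosed_eq (hc _) continuous_const
  · exact isClosed_iInter fun x => isClosed_iInter fun y => isClosed_eq (hc _) (hc _)
  · exact isClosed_iInter fun x => isClosed_iInter fun y => isClosed_iInter fun z =>
      isClosed_le (hc _) ((hc _).add (hc _))

lemma add_mem_boundedPseudometrics {X : Type*} [TopologicalSpace X]
    {f g : BoundedContinuousFunction (X × X) ℝ} (hf : f ∈ boundedPseudometrics X)
    (hg : g ∈ boundedPseudometrics X) : f + g ∈ boundedPseudometrics X := by
  obtain ⟨hf0, hfs, hft⟩ := hf
  obtain ⟨hg0, hgs, hgt⟩ := hg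
  refine ⟨fun x => ?_, fun x y => ?_, fun x y z => ?_⟩
  · simp [hf0, hg0]
  · simp [hfs x y, hgs x y]
  · simp only [coe_add, Pi.add_apply]
    linarith [hft x y z, hgt x y z]

/-- A bounded continuous pseudometric dominating an admissible metric is admissible. -/
lemma mem_AM_of_le {X : Type*} [TopologicalSpace X]
    {d f : BoundedContinuousFunction (X × X) ℝ} (hd : d ∈ AM X)
    (hf : f ∈ boundedPseudometrics X) (hdf : ∀ p, d p ≤ f p) : f ∈ AM X := by
  have hd' : d ∈ boundedPseudometrics X :=
    ⟨fun x => (hd.1.1 x x).2 rfl, hd.1.2.1, hd.1.2.2⟩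
  refine ⟨⟨fun x y => ⟨fun h => ?_, ?_⟩, hf.2.1, hf.2.2⟩, fun s => ⟨fun hs x hx => ?_, fun h => ?_⟩⟩
  · exact (hd.1.1 x y).1 (le_antisymm (h ▸ hdf (x, y)) (boundedPseudometrics_nonneg hd' x y))
  · rintro rfl
    exact hf.1 x
  · obtain ⟨ε, hε, H⟩ := (hd.2 s).1 hs x hx
    exact ⟨ε, hε, fun y hy => H y ((hdf _).trans_lt hy)⟩
  · rw [isOpen_iff_mem_nhds]
    intro x hx
    obtain ⟨ε, hε, H⟩ := h x hx
    have hc : Continuous fun y => f (x, y) := f.continuous.comp (by fun_prop)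
    have hlt : f (x, x) < ε := by rwa [hf.1]
    exact Filter.mem_of_superset ((isOpen_lt hc continuous_const).mem_nhds hlt) H

lemma AM_nonempty (X : Type*) [TopologicalSpace X] [TopologicalSpace.MetrizableSpace X] :
    (AM X).Nonempty := by
  let := TopologicalSpace.metrizableSpaceMetric X
  refine ⟨BoundedContinuousFunction.ofNormedAddCommGroup (fun p : X × X => min 1 (dist p.1 p.2))
    (by fun_prop) 1 fun p => ?_, ⟨fun x y => ?_, fun x y => ?_, fun x y z => ?_⟩, fun s => ?_⟩
  · rw [Real.norm_eq_abs, abs_of_nonneg (le_min zero_le_one dist_nonneg)]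
    exact min_le_left _ _
  · change min 1 (dist x y) = 0 ↔ x = y
    rw [← dist_eq_zero (x := x)]
    grind
  · change min 1 (dist x y) = min 1 (dist y x)
    rw [dist_comm]
  · change min 1 (dist x z) ≤ min 1 (dist x y) + min 1 (dist y z)
    have := dist_triangle x y z
    have := dist_nonneg (x := x) (y := y)
    have := dist_nonneg (x := y) (y := z)
    grind
  · change IsOpen s ↔ ∀ x ∈ s, ∃ ε > 0, ∀ y : X, min 1 (dist x y) < ε → y ∈ s
    rw [Metric.isOpen_iff]
    refine forall₂_congr fun x _ => ⟨?_, ?_⟩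
    · rintro ⟨ε, hε, H⟩
      refine ⟨min 1 ε, lt_min one_pos hε, fun y hy => H ?_⟩
      rw [Metric.mem_ball, dist_comm]
      grind
    · rintro ⟨ε, hε, H⟩
      refine ⟨ε, hε, fun y hy => H y ?_⟩
      rw [Metric.mem_ball, dist_comm] at hy
      exact (min_le_right _ _).trans_lt hy

/-- An infinite metrizable space carries an infinite uniformly separated family of continuous
pseudometrics of arbitrarily small norm. -/
lemma exists_separated_boundedPseudometrics (X : Type*) [TopologicalSpace X]
    [TopologicalSpace.MetrizableSpace X] [Infinite X] {r : ℝ} (hr : 0 < r) :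
    ∃ e : ℕ → BoundedContinuousFunction (X × X) ℝ, (∀ n, e n ∈ boundedPseudometrics X) ∧
      (∀ n, ‖e n‖ ≤ r) ∧ ∀ m n, m ≠ n → r ≤ dist (e m) (e n) := by
  let := TopologicalSpace.metrizableSpaceMetric X
  obtain ⟨U, hUinf, hUo, hUd⟩ := exists_seq_infinite_isOpen_pairwise_disjoint X
  choose x hx using fun n => (hUinf n).nonempty
  have hb (n : ℕ) : ∃ f : C(X, ℝ), EqOn f 0 (U n)ᶜ ∧ EqOn f 1 {x n} ∧ ∀ y, f y ∈ Icc (0 : ℝ) 1 :=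
    exists_continuous_zero_one_of_isClosed (hUo n).isClosed_compl isClosed_singleton
      (by simpa using hx n)
  choose f hf0 hf1 hf using hb
  have hsame (n : ℕ) : f n (x n) = 1 := hf1 n rfl
  have hdiff (m n : ℕ) (hmn : m ≠ n) : f m (x n) = 0 :=
    hf0 m fun h => disjoint_left.1 (hUd hmn) h (hx n)
  have hle (n : ℕ) (p : X × X) : ‖r * |f n p.1 - f n p.2|‖ ≤ r := by
    rw [Real.norm_eq_abs, abs_of_nonneg (by positivity)]
    have h1 := hf n p.1
    have h2 := hf n p.2
    have : |f n p.1 - f n p.2| ≤ 1 := abs_le.2 ⟨by linarith [h1.1, h2.2], by linarith [h1.2, h2.1]⟩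
    nlinarith
  let e (n : ℕ) : BoundedContinuousFunction (X × X) ℝ :=
    BoundedContinuousFunction.ofNormedAddCommGroup (fun p : X × X => r * |f n p.1 - f n p.2|)
      (by fun_prop) r (hle n)
  have he (n : ℕ) (y z : X) : e n (y, z) = r * |f n y - f n z| := rfl
  refine ⟨fun n => e (n + 1), fun n => ⟨fun y => ?_, fun y z => ?_, fun y z w => ?_⟩, fun n => ?_,
    fun m n hmn => ?_⟩
  · simp [he]
  · rw [he, he, abs_sub_comm]
  · rw [he, he, he, ← mul_add]
    exact mul_le_mul_of_nonneg_left (abs_sub_le _ _ _) hr.le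
  · exact norm_ofNormedAddCommGroup_le _ hr.le _
  · have h := dist_coe_le_dist (f := e (m + 1)) (g := e (n + 1)) (x (m + 1), x 0)
    rw [he, he, hsame, hdiff _ _ (by lia), hdiff _ _ (by lia), hdiff _ _ (by lia)] at h
    simpa [Real.dist_eq, abs_of_pos hr] using h

lemma IsCompact.not_exists_separated_seq {Y : Type*} [PseudoMetricSpace Y] {C : Set Y}
    (hC : IsCompact C) {r : ℝ} (hr : 0 < r) {u : ℕ → Y} (hu : ∀ n, u n ∈ C)
    (hsep : ∀ m n, m ≠ n → r ≤ dist (u m) (u n)) : False := by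
  obtain ⟨a, -, φ, hφ, hlim⟩ := hC.tendsto_subseq hu
  obtain ⟨N, hN⟩ := Metric.cauchySeq_iff.1 hlim.cauchySeq r hr
  exact (hsep _ _ (hφ (Nat.lt_succ_self N)).ne).not_gt (hN N le_rfl (N + 1) (Nat.le_succ N))

lemma finite_of_sigmaLocallyCompact_AM (X : Type*) [TopologicalSpace X]
    [TopologicalSpace.MetrizableSpace X] (h : SigmaLocallyCompact ↥(AM X)) : Finite X := by
  by_contra hX
  rw [not_finite_iff_infinite] at hX
  obtain ⟨F, hFc, hFl, hFu⟩ := h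
  obtain ⟨d, hd⟩ := AM_nonempty X
  have hdP : d ∈ boundedPseudometrics X :=
    ⟨fun x => (hd.1.1 x x).2 rfl, hd.1.2.1, hd.1.2.2⟩
  let φ (e : boundedPseudometrics X) : AM X :=
    ⟨d + e, mem_AM_of_le hd (add_mem_boundedPseudometrics hdP e.2) fun p =>
      le_add_of_nonneg_right (boundedPseudometrics_nonneg e.2 p.1 p.2)⟩
  have hφ : Isometry φ := Isometry.of_dist_eq fun a b => dist_add_left d a.1 b.1
  have : CompleteSpace (boundedPseudometrics X) :=
    (isClosed_boundedPseudometrics X).completeSpace_coe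
  have : Nonempty (boundedPseudometrics X) := ⟨⟨d, hdP⟩⟩
  obtain ⟨n, e₀, he₀⟩ := nonempty_interior_of_iUnion_of_closed
    (fun n => (hFc n).preimage hφ.continuous) (by rw [← preimage_iUnion, hFu, preimage_univ])
  rw [mem_interior_iff_mem_nhds] at he₀
  have := hFl n
  have hφe₀ : e₀ ∈ φ ⁻¹' F n := mem_of_mem_nhds he₀
  obtain ⟨C, hC, hCn⟩ := exists_compact_mem_nhds (⟨φ e₀, hφe₀⟩ : F n)
  rw [nhds_subtype_eq_comap, mem_comap] at hCn
  obtain ⟨V, hV, hVC⟩ := hCn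
  obtain ⟨r, hr, hball⟩ := Metric.nhds_basis_closedBall.mem_iff.1
    (Filter.inter_mem he₀ (hφ.continuous.continuousAt hV))
  obtain ⟨e, heP, her, hsep⟩ := exists_separated_boundedPseudometrics X hr
  let u (k : ℕ) : boundedPseudometrics X := ⟨e₀ + e k, add_mem_boundedPseudometrics e₀.2 (heP k)⟩
  have hu (k : ℕ) : u k ∈ φ ⁻¹' F n ∩ φ ⁻¹' V := hball <| by
    change dist (e₀.1 + e k) e₀.1 ≤ r
    rw [dist_eq_norm, add_sub_cancel_left]
    exact her k
  refine hC.not_exists_separated_seq hr (u := fun k => ⟨φ (u k), (hu k).1⟩)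
    (fun k => hVC (hu k).2) fun k l hkl => ?_
  change r ≤ dist (φ (u k)) (φ (u l))
  rw [hφ.dist_eq]
  change r ≤ dist (e₀.1 + e k) (e₀.1 + e l)
  rw [dist_add_left]
  exact hsep k l hkl

/-- If `X` is metrizable and `AM(X)` with the sup-metric is σ-locally
compact, then `X` is completely metrizable. -/
theorem completelyMetrizable_of_sigmaLocallyCompact_AM (X : Type*) [TopologicalSpace X]
    [TopologicalSpace.MetrizableSpace X] (h : SigmaLocallyCompact ↥(AM X)) :
    CompletelyMetrizable X := by
  have := finite_of_sigmaLocallyCompact_AM X h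
  let := TopologicalSpace.metrizableSpaceMetric X
  exact ⟨inferInstance, rfl, inferInstance⟩
end

section
/- Let P = [0,1] ∩ ℙ be the set of irrationals in [0,1] with the subspace topology from ℝ, and let X be the topological sum P ⊕ (0,1]. Then X is a separable metrizable space, and the space AM(X) of bounded admissible metrics on X, endowed with the sup-metric, is not completely metrizable. -/
open Set Filter Topology UniformConvergence

/-- `P = [0,1] ∩ ℙ`, the irrationals in the unit interval. -/
def Pset : Set ℝ := Set.Icc 0 1 ∩ {x | Irrational x}

/-- `Q = [0,1] ∩ ℚ`, the rationals in the unit interval. -/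
def Qset : Set ℝ := Set.Icc 0 1 ∩ Set.range ((↑) : ℚ → ℝ)

/-- The topological sum `X = P ⊕ (0,1]`. -/
abbrev Xsum : Type := ↥Pset ⊕ ↥(Set.Ioc (0 : ℝ) 1)

/-- The metric `d_q` on `X = P ⊕ (0,1]` associated to `q`. -/
noncomputable def dq (q : ℝ) : Xsum × Xsum → ℝ
  | (Sum.inl x, Sum.inl y) => |(x : ℝ) - (y : ℝ)|
  | (Sum.inr x, Sum.inr y) => |(x : ℝ) - (y : ℝ)|
  | (Sum.inl x, Sum.inr y) => |(x : ℝ) - q| + (y : ℝ)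
  | (Sum.inr x, Sum.inl y) => (x : ℝ) + |(y : ℝ) - q|

theorem dq_isMetricFun {q : ℝ} : IsMetricFun (dq q) := by
  refine ⟨?_, ?_, ?_⟩
  · rintro (x | x) (y | y)
    · simp [dq, sub_eq_zero, Subtype.ext_iff]
    · have := y.2.1
      have := abs_nonneg ((x : ℝ) - q)
      simp only [dq, reduceCtorEq, iff_false]
      linarith
    · have := x.2.1
      have := abs_nonneg ((y : ℝ) - q)
      simp only [dq, reduceCtorEq, iff_false]
      linarith
    · simp [dq, sub_eq_zero, Subtype.ext_iff]
  · rintro (x | x) (y | y) <;> simp [dq, abs_sub_comm, add_comm]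
  · rintro (x | x) (y | y) (z | z) <;> simp only [dq]
    · exact abs_sub_le _ _ _
    · have := abs_sub_le (x : ℝ) y q
      linarith
    · have := abs_sub_le (x : ℝ) q z
      have := abs_sub_comm (z : ℝ) q
      have := y.2.1
      linarith
    · have := neg_abs_le ((y : ℝ) - z)
      linarith
    · have := abs_sub_le (z : ℝ) y q
      have := abs_sub_comm (z : ℝ) y
      linarith
    · have := x.2.1
      have := z.2.1
      have : |(x : ℝ) - z| ≤ x + z := abs_le.2 ⟨by linarith, by linarith⟩
      have := abs_nonneg ((y : ℝ) - q)
      linarith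
    · have := le_abs_self ((x : ℝ) - y)
      linarith
    · exact abs_sub_le _ _ _

theorem continuous_dq (q : ℝ) : Continuous (dq q) := by
  have hl := IsOpenEmbedding.inl (X := ↥Pset) (Y := ↥(Set.Ioc (0 : ℝ) 1))
  have hr := IsOpenEmbedding.inr (X := ↥Pset) (Y := ↥(Set.Ioc (0 : ℝ) 1))
  rw [continuous_iff_continuousAt]
  rintro ⟨x | x, y | y⟩
  · refine (hl.prodMap hl).continuousAt_iff (x := (x, y)) |>.1 (Continuous.continuousAt ?_)
    change Continuous fun p : ↥Pset × ↥Pset => |(p.1 : ℝ) - p.2|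
    fun_prop
  · refine (hl.prodMap hr).continuousAt_iff (x := (x, y)) |>.1 (Continuous.continuousAt ?_)
    change Continuous fun p : ↥Pset × ↥(Set.Ioc (0 : ℝ) 1) => |(p.1 : ℝ) - q| + p.2
    fun_prop
  · refine (hr.prodMap hl).continuousAt_iff (x := (x, y)) |>.1 (Continuous.continuousAt ?_)
    change Continuous fun p : ↥(Set.Ioc (0 : ℝ) 1) × ↥Pset => (p.1 : ℝ) + |(p.2 : ℝ) - q|
    fun_prop
  · refine (hr.prodMap hr).continuousAt_iff (x := (x, y)) |>.1 (Continuous.continuousAt ?_)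
    change Continuous fun p : ↥(Set.Ioc (0 : ℝ) 1) × ↥(Set.Ioc (0 : ℝ) 1) => |(p.1 : ℝ) - p.2|
    fun_prop

theorem abs_dq_le {q : ℝ} (hq : q ∈ Icc (0 : ℝ) 1) (p : Xsum × Xsum) : |dq q p| ≤ 2 := by
  obtain ⟨hq0, hq1⟩ := hq
  have key : ∀ a b : ℝ, 0 ≤ a → a ≤ 1 → 0 ≤ b → b ≤ 1 → |a - b| ≤ 1 := fun a b _ _ _ _ =>
    abs_le.2 ⟨by linarith, by linarith⟩
  obtain ⟨x | x, y | y⟩ := p <;> simp only [dq]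
  · have := key x y x.2.1.1 x.2.1.2 y.2.1.1 y.2.1.2
    rw [abs_abs]
    linarith
  · have := key x q x.2.1.1 x.2.1.2 hq0 hq1
    have h0 := y.2.1
    have := y.2.2
    rw [abs_of_nonneg (by positivity)]
    linarith
  · have := key y q y.2.1.1 y.2.1.2 hq0 hq1
    have h0 := x.2.1
    have := x.2.2
    rw [abs_of_nonneg (by positivity)]
    linarith
  · have := key x y x.2.1.le x.2.2 y.2.1.le y.2.2
    rw [abs_abs]
    linarith

/-- The metric `dq q`, for `q ∈ [0,1]`, as a bounded continuous function. -/
noncomputable def dqBCF (q : Icc (0 : ℝ) 1) : BoundedContinuousFunction (Xsum × Xsum) ℝ :=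
  BoundedContinuousFunction.ofNormedAddCommGroup (dq q) (continuous_dq q) 2 (abs_dq_le q.2)

theorem coe_dqBCF (q : Icc (0 : ℝ) 1) : ⇑(dqBCF q) = dq q := rfl

theorem dist_dq_le (q r : ℝ) (p : Xsum × Xsum) : dist (dq q p) (dq r p) ≤ |q - r| := by
  have key : ∀ x : ℝ, |(|x - q| - |x - r|)| ≤ |q - r| := fun x => by
    refine (abs_abs_sub_abs_le _ _).trans_eq ?_
    rw [abs_sub_comm q r]
    congr 1
    ring
  rw [Real.dist_eq]
  obtain ⟨x | x, y | y⟩ := p <;> simp [dq, key]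

theorem continuous_dqBCF : Continuous dqBCF := by
  refine (LipschitzWith.of_dist_le_mul (K := 1) fun q r => ?_).continuous
  rw [NNReal.coe_one, one_mul]
  exact (BoundedContinuousFunction.dist_le dist_nonneg).2 fun p => dist_dq_le q r p

theorem injective_dqBCF : Function.Injective dqBCF := by
  intro q r h
  by_contra hne
  wlog hlt : q < r generalizing q r
  · exact this h.symm (Ne.symm hne) (lt_of_le_of_ne (not_lt.1 hlt) (Ne.symm hne))
  have hlt' : (q : ℝ) < r := hlt
  obtain ⟨x, hx, hq, hr⟩ := exists_irrational_btwn (show (q : ℝ) < (q + r) / 2 by linarith)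
  have hxP : x ∈ Pset := ⟨⟨by linarith [q.2.1], by linarith [r.2.2]⟩, hx⟩
  have heq : dq q (Sum.inl ⟨x, hxP⟩, Sum.inr ⟨1, by simp⟩) =
      dq r (Sum.inl ⟨x, hxP⟩, Sum.inr ⟨1, by simp⟩) := by
    rw [← coe_dqBCF, ← coe_dqBCF, h]
  simp only [dq] at heq
  rw [abs_of_pos (by linarith), abs_of_neg (by linarith)] at heq
  linarith

theorem dq_inducesTopology {q : ℝ} (hq : q ∉ Pset) : InducesTopology (dq q) := by
  intro s
  constructor
  · intro hs
    rw [isOpen_sum_iff] at hs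
    rintro (x | x) hx
    · obtain ⟨ε, hε, hb⟩ := Metric.isOpen_iff.1 hs.1 x hx
      have hxq : 0 < |(x : ℝ) - q| :=
        abs_pos.2 (sub_ne_zero.2 fun h => hq (h ▸ x.2))
      refine ⟨min ε |(x : ℝ) - q|, lt_min hε hxq, ?_⟩
      rintro (y | y) hy <;> simp only [dq, lt_min_iff] at hy
      · refine hb (Metric.mem_ball'.2 ?_)
        rw [Subtype.dist_eq, Real.dist_eq]
        exact hy.1
      · linarith [y.2.1]
    · obtain ⟨ε, hε, hb⟩ := Metric.isOpen_iff.1 hs.2 x hx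
      refine ⟨min ε x, lt_min hε x.2.1, ?_⟩
      rintro (y | y) hy <;> simp only [dq, lt_min_iff] at hy
      · linarith [abs_nonneg ((y : ℝ) - q)]
      · refine hb (Metric.mem_ball'.2 ?_)
        rw [Subtype.dist_eq, Real.dist_eq]
        exact hy.1
  · intro h
    rw [isOpen_iff_mem_nhds]
    intro x hx
    obtain ⟨ε, hε, hb⟩ := h x hx
    have hopen : IsOpen {y | dq q (x, y) < ε} :=
      isOpen_lt ((continuous_dq q).comp (Continuous.prodMk_right x)) continuous_const
    refine mem_of_superset (hopen.mem_nhds ?_) hb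
    change dq q (x, x) < ε
    rwa [(dq_isMetricFun.1 x x).2 rfl]

theorem not_inducesTopology_dq {q : ℝ} (hq : q ∈ Pset) : ¬ InducesTopology (dq q) := by
  intro h
  obtain ⟨ε, hε, hb⟩ := (h (range Sum.inl)).1 isOpen_range_inl (Sum.inl ⟨q, hq⟩) ⟨_, rfl⟩
  have hpos : 0 < min (ε / 2) 1 := lt_min (by linarith) one_pos
  obtain ⟨z, hz⟩ := hb (Sum.inr ⟨min (ε / 2) 1, hpos, min_le_right _ _⟩) (by
    have := min_le_left (ε / 2) 1
    simp only [dq, sub_self, abs_zero, zero_add]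
    linarith)
  exact Sum.inl_ne_inr hz

theorem dqBCF_mem_AM_iff (q : Icc (0 : ℝ) 1) : dqBCF q ∈ AM Xsum ↔ ¬ Irrational (q : ℝ) := by
  constructor
  · exact fun h hq => not_inducesTopology_dq ⟨q.2, hq⟩ h.2
  · exact fun h => ⟨dq_isMetricFun, dq_inducesTopology fun hq => h hq.2⟩

theorem exists_isOpen_singleton_of_countable {S : Type*} [TopologicalSpace S] [T1Space S]
    [BaireSpace S] [Countable S] [Nonempty S] : ∃ x : S, IsOpen {x} := by
  obtain ⟨x, y, hy⟩ := nonempty_interior_of_iUnion_of_closed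
    (fun x : S => isClosed_singleton (x := x)) (iUnion_of_singleton S)
  have hyx : y = x := mem_singleton_iff.1 (interior_subset hy)
  rw [hyx] at hy
  exact ⟨x, interior_eq_iff_isOpen.1 (subset_antisymm interior_subset (singleton_subset_iff.2 hy))⟩

theorem not_isOpen_singleton_rational {S : Set (Icc (0 : ℝ) 1)}
    (hS : ∀ q : Icc (0 : ℝ) 1, q ∈ S ↔ ¬ Irrational (q : ℝ)) (x : S) : ¬ IsOpen {x} := by
  intro h
  obtain ⟨ε, hε, hb⟩ := Metric.isOpen_iff.1 h x rfl
  have h0 := x.1.2.1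
  have h1 := x.1.2.2
  have key : ∀ a b : ℝ, a < b → 0 ≤ a → b ≤ 1 → (x : ℝ) - ε ≤ a → b ≤ x + ε →
      (b ≤ x ∨ (x : ℝ) ≤ a) → False := by
    intro a b hab ha hb' hxa hxb hne
    obtain ⟨r, hra, hrb⟩ := exists_rat_btwn hab
    have hr : (⟨r, by linarith, by linarith⟩ : Icc (0 : ℝ) 1) ∈ S :=
      (hS _).2 fun hirr => hirr ⟨r, rfl⟩
    have hmem : (⟨_, hr⟩ : S) ∈ ({x} : Set S) := hb (Metric.mem_ball.2 (by
      rw [Subtype.dist_eq, Subtype.dist_eq, Real.dist_eq, abs_lt]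
      constructor <;> dsimp only <;> linarith))
    have heq : (r : ℝ) = x := congrArg (fun s : S => ((s : Icc (0 : ℝ) 1) : ℝ)) hmem
    rcases hne with hne | hne <;> linarith
  rcases h1.lt_or_eq with hlt | heq
  · exact key x (min 1 (x + ε)) (lt_min hlt (by linarith)) h0 (min_le_left _ _) (by linarith)
      (min_le_right _ _) (Or.inr le_rfl)
  · exact key (max 0 (x - ε)) x (max_lt (by linarith) (by linarith)) (le_max_left _ _) h1
      (le_max_right _ _) (by linarith) (Or.inl le_rfl)

theorem countable_of_forall_not_irrational {S : Set (Icc (0 : ℝ) 1)}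
    (hS : ∀ q ∈ S, ¬ Irrational (q : ℝ)) : S.Countable := by
  refine ((countable_range ((↑) : ℚ → ℝ)).preimage Subtype.val_injective).mono fun q hq => ?_
  exact not_not.1 (hS q hq)

/-- `X = P ⊕ (0,1]` (with `P = [0,1] ∩ ℙ`) is a separable metrizable
space whose space `AM(X)` of bounded admissible metrics, endowed with the sup-metric,
is not completely metrizable. -/
theorem example_AM_not_completelyMetrizable :
    TopologicalSpace.SeparableSpace Xsum ∧ TopologicalSpace.MetrizableSpace Xsum ∧
      ¬ CompletelyMetrizable ↥(AM Xsum) := by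
  refine ⟨inferInstance, TopologicalSpace.metrizableSpace_of_t3_secondCountable _, ?_⟩
  rintro ⟨m, hm, hc⟩
  have : TopologicalSpace.IsCompletelyMetrizableSpace ↥(AM Xsum) := ⟨m, hm, hc⟩
  have hemb : IsClosedEmbedding dqBCF := continuous_dqBCF.isClosedEmbedding injective_dqBCF
  have : TopologicalSpace.IsCompletelyMetrizableSpace ↥(dqBCF ⁻¹' AM Xsum) :=
    (hemb.restrictPreimage (AM Xsum)).IsCompletelyMetrizableSpace
  have : Countable ↥(dqBCF ⁻¹' AM Xsum) :=
    (countable_of_forall_not_irrational fun q hq => (dqBCF_mem_AM_iff q).1 hq).to_subtype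
  have : Nonempty ↥(dqBCF ⁻¹' AM Xsum) := ⟨⟨0, (dqBCF_mem_AM_iff 0).2 (by simp)⟩⟩
  obtain ⟨x, hx⟩ := exists_isOpen_singleton_of_countable (S := ↥(dqBCF ⁻¹' AM Xsum))
  exact not_isOpen_singleton_rational dqBCF_mem_AM_iff x hx
end

section
/- Let P = [0,1] ∩ ℙ, let X be the topological sum P ⊕ (0,1], and for q ∈ Q = [0,1] ∩ ℚ define d_q : X × X → ℝ by d_q(x,y) = |x − y| if (x,y) ∈ P² or (x,y) ∈ (0,1]², d_q(x,y) = |x − q| + y if x ∈ P and y ∈ (0,1], and d_q(x,y) = x + |y − q| if x ∈ (0,1] and y ∈ P. Then for every q ∈ Q, d_q is a bounded metric on X that induces the topology of X; that is, d_q ∈ AM(X). -/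
open Set Filter Topology UniformConvergence

/-- The distance from an irrational to a rational is positive. -/
lemma abs_sub_pos_of_mem_Pset_of_mem_Qset {x q : ℝ} (hx : x ∈ Pset) (hq : q ∈ Qset) :
    0 < |x - q| := by
  obtain ⟨r, rfl⟩ := hq.2
  exact abs_pos.2 (sub_ne_zero.2 (hx.2.ne_rat r))

lemma isMetricFun_dq {q : ℝ} (hq : q ∈ Qset) : IsMetricFun (dq q) := by
  refine ⟨?_, ?_, ?_⟩
  · rintro (x | x) (y | y)
    · simp [dq, sub_eq_zero, Subtype.ext_iff]
    · have := abs_sub_pos_of_mem_Pset_of_mem_Qset x.2 hq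
      have := y.2.1
      simp only [dq, reduceCtorEq, iff_false]
      linarith
    · have := abs_sub_pos_of_mem_Pset_of_mem_Qset y.2 hq
      have := x.2.1
      simp only [dq, reduceCtorEq, iff_false]
      linarith
    · simp [dq, sub_eq_zero, Subtype.ext_iff]
  · rintro (x | x) (y | y)
    · exact abs_sub_comm _ _
    · exact add_comm _ _
    · exact add_comm _ _
    · exact abs_sub_comm _ _
  · rintro (x | x) (y | y) (z | z) <;> simp only [dq]
    · exact abs_sub_le _ _ _
    · linarith [abs_sub_le (x : ℝ) y q]
    · linarith [abs_sub_le (x : ℝ) q z, abs_sub_comm q (z : ℝ), y.2.1]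
    · linarith [le_abs_self ((z : ℝ) - y), abs_sub_comm (z : ℝ) y]
    · linarith [abs_sub_le (z : ℝ) y q, abs_sub_comm (z : ℝ) y]
    · have : |(x : ℝ) - z| ≤ x + z := abs_sub_le_iff.2
        ⟨by linarith [z.2.1], by linarith [x.2.1]⟩
      linarith [abs_nonneg ((y : ℝ) - q)]
    · linarith [le_abs_self ((x : ℝ) - y)]
    · exact abs_sub_le _ _ _

lemma inducesTopology_dq {q : ℝ} (hq : q ∈ Qset) : InducesTopology (dq q) := by
  intro s
  simp only [isOpen_sum_iff, Metric.isOpen_iff, Set.subset_def, Metric.mem_ball,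
    Subtype.dist_eq, Real.dist_eq]
  constructor
  · rintro ⟨hl, hr⟩ (x | x) hx
    · obtain ⟨ε, hε, h⟩ := hl x hx
      refine ⟨min ε |(x : ℝ) - q|,
        lt_min hε (abs_sub_pos_of_mem_Pset_of_mem_Qset x.2 hq), ?_⟩
      rintro (y | y) hy <;> simp only [dq, lt_min_iff] at hy
      · exact h y (by rw [abs_sub_comm]; exact hy.1)
      · linarith [y.2.1]
    · obtain ⟨ε, hε, h⟩ := hr x hx
      refine ⟨min ε x, lt_min hε x.2.1, ?_⟩
      rintro (y | y) hy <;> simp only [dq, lt_min_iff] at hy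
      · linarith [abs_nonneg ((y : ℝ) - q)]
      · exact h y (by rw [abs_sub_comm]; exact hy.1)
  · intro h
    constructor <;> intro x hx <;> obtain ⟨ε, hε, hs⟩ := h _ hx <;>
      exact ⟨ε, hε, fun y hy => hs _ (by simpa only [dq, abs_sub_comm] using hy)⟩

lemma boundedFun_dq {q : ℝ} (hq : q ∈ Qset) : BoundedFun (dq q) := by
  have key : ∀ {a b : ℝ}, a ∈ Set.Icc (0 : ℝ) 1 → b ∈ Set.Icc (0 : ℝ) 1 → |a - b| ≤ 1 :=
    fun ha hb => abs_sub_le_iff.2 ⟨by linarith [ha.2, hb.1], by linarith [ha.1, hb.2]⟩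
  refine ⟨2, ?_⟩
  rintro ⟨x | x, y | y⟩ <;> simp only [dq]
  · rw [abs_abs]
    linarith [key x.2.1 y.2.1]
  · rw [abs_of_nonneg (add_nonneg (abs_nonneg _) y.2.1.le)]
    linarith [key x.2.1 hq.1, y.2.2]
  · rw [abs_of_nonneg (add_nonneg x.2.1.le (abs_nonneg _))]
    linarith [key y.2.1 hq.1, x.2.2]
  · rw [abs_abs]
    linarith [key (Set.Ioc_subset_Icc_self x.2) (Set.Ioc_subset_Icc_self y.2)]

/-- For every `q ∈ Q = [0,1] ∩ ℚ`, the function `d_q` is a bounded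
metric on `X = P ⊕ (0,1]` inducing its topology, i.e. `d_q ∈ AM(X)`. -/
theorem dq_mem_AM : ∀ q ∈ Qset,
    IsMetricFun (dq q) ∧ InducesTopology (dq q) ∧ BoundedFun (dq q) := by
  exact fun q hq => ⟨isMetricFun_dq hq, inducesTopology_dq hq, boundedFun_dq hq⟩
end

section
/- Let P = [0,1] ∩ ℙ, let X be the topological sum P ⊕ (0,1], and for q ∈ Q = [0,1] ∩ ℚ define d_q : X × X → ℝ by d_q(x,y) = |x − y| if (x,y) ∈ P² or (x,y) ∈ (0,1]², d_q(x,y) = |x − q| + y if x ∈ P and y ∈ (0,1], and d_q(x,y) = x + |y − q| if x ∈ (0,1] and y ∈ P. Then for all q, p ∈ Q, the sup-metric distance satisfies D(d_q, d_p) = sup{|d_q(x,y) − d_p(x,y)| : (x,y) ∈ X²} = |q − p|; in particular, the map q ↦ d_q is an isometry of Q onto its image. -/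
open Set Filter Topology UniformConvergence

/-- Changing the parameter from `p` to `q` moves every value of `dq` by at most `|q - p|`. -/
theorem abs_dq_sub_dq_le (q p : ℝ) (z : Xsum × Xsum) : |dq q z - dq p z| ≤ |q - p| := by
  have key (x : ℝ) : |(|x - q| - |x - p|)| ≤ |q - p| := by
    have h := abs_abs_sub_abs_le (x - q) (x - p)
    rwa [sub_sub_sub_cancel_left, abs_sub_comm p q] at h
  rcases z with ⟨x | x, y | y⟩
  · simp [dq]
  · simpa [dq] using key x
  · simpa [dq] using key y
  · simp [dq]

/-- The pairs in `P × (0,1]` already give values of `|dq q - dq p|` arbitrarily close to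
`|q - p|`. -/
theorem exists_lt_abs_dq_sub_dq {q p : ℝ} (hq : q ∈ Icc (0 : ℝ) 1) (hp : p ∈ Icc (0 : ℝ) 1)
    (hne : q ≠ p) {c : ℝ} (hc : c < |q - p|) : ∃ z : Xsum × Xsum, c < |dq q z - dq p z| := by
  wlog hlt : q < p generalizing q p
  · obtain ⟨z, hz⟩ := this hp hq hne.symm (by rwa [abs_sub_comm])
      (lt_of_le_of_ne (not_lt.1 hlt) hne.symm)
    exact ⟨z, by rwa [abs_sub_comm]⟩
  rw [abs_sub_comm, abs_of_pos (sub_pos.2 hlt)] at hc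
  obtain ⟨x, hx, hqx, hxu⟩ := exists_irrational_btwn
    (show q < min p (q + (p - q - c) / 2) from lt_min hlt (by linarith))
  obtain ⟨hxp, hxc⟩ := lt_min_iff.1 hxu
  refine ⟨(Sum.inl ⟨x, ⟨hq.1.trans hqx.le, hxp.le.trans hp.2⟩, hx⟩,
    Sum.inr ⟨1, one_pos, le_rfl⟩), ?_⟩
  simp only [dq, add_sub_add_right_eq_sub]
  rw [abs_of_pos (sub_pos.2 hqx), abs_of_neg (sub_neg.2 hxp), abs_sub_comm]
  exact lt_of_lt_of_le (by linarith) (le_abs_self _)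

/-- For all `q, p ∈ Q = [0,1] ∩ ℚ`, the sup-metric distance between `d_q`
and `d_p` equals `|q - p|`; in particular `q ↦ d_q` is an isometry onto its image. -/
theorem dist_dq_eq : ∀ q ∈ Qset, ∀ p ∈ Qset,
    (⨆ z : Xsum × Xsum, |dq q z - dq p z|) = |q - p| := by
  intro q hq p hp
  have : Nonempty Xsum := ⟨Sum.inr ⟨1, one_pos, le_rfl⟩⟩
  refine le_antisymm (ciSup_le (abs_dq_sub_dq_le q p)) ?_
  have hbdd : BddAbove (range fun z : Xsum × Xsum => |dq q z - dq p z|) :=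
    ⟨|q - p|, forall_mem_range.2 (abs_dq_sub_dq_le q p)⟩
  rcases eq_or_ne q p with rfl | hne
  · simp
  · refine le_of_forall_lt fun c hc => ?_
    obtain ⟨z, hz⟩ := exists_lt_abs_dq_sub_dq hq.1 hp.1 hne hc
    exact hz.trans_le (le_ciSup hbdd z)
end

section
/- Let P = [0,1] ∩ ℙ, let X be the topological sum P ⊕ (0,1], and for q ∈ Q = [0,1] ∩ ℚ define d_q : X × X → ℝ by d_q(x,y) = |x − y| if (x,y) ∈ P² or (x,y) ∈ (0,1]², d_q(x,y) = |x − q| + y if x ∈ P and y ∈ (0,1], and d_q(x,y) = x + |y − q| if x ∈ (0,1] and y ∈ P. Then the set S = {d_q : q ∈ Q} is closed in AM(X) with respect to the sup-metric topology; that is, if a sequence (d_{q_n}) with q_n ∈ Q converges uniformly to some bounded admissible metric d ∈ AM(X), then d = d_z for some z ∈ Q. -/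
open Set Filter Topology UniformConvergence

/-- For a fixed pair of points, `d_q` depends continuously on `q`. -/
lemma continuous_dq_apply (p : Xsum × Xsum) : Continuous fun q => dq q p := by
  rcases p with ⟨x | x, y | y⟩ <;> simp only [dq] <;> fun_prop

/-- If `z` is irrational, then `d_z` does not induce the topology of `X`: the points of `(0,1]`
near `0` are close to `z ∈ P`, although `P` is open in `X`. -/
lemma not_inducesTopology_dq_s9 {z : ℝ} (hz : z ∈ Pset) : ¬ InducesTopology (dq z) := by
  intro h
  obtain ⟨ε, hε, hball⟩ :=
    (h (range Sum.inl)).1 isOpen_range_inl (Sum.inl ⟨z, hz⟩) (mem_range_self _)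
  have hy : min (ε / 2) 1 ∈ Ioc (0 : ℝ) 1 :=
    ⟨lt_min (half_pos hε) one_pos, min_le_right _ _⟩
  have hlt : dq z (Sum.inl ⟨z, hz⟩, Sum.inr ⟨min (ε / 2) 1, hy⟩) < ε := by
    simp only [dq, sub_self, abs_zero, zero_add]
    exact (min_le_left _ _).trans_lt (half_lt_self hε)
  obtain ⟨w, hw⟩ := hball _ hlt
  exact Sum.inl_ne_inr hw

/-- The set `S = {d_q : q ∈ Q}` is closed in `AM(X)` for the sup-metric:
if a sequence `(d_{qₙ})` with `qₙ ∈ Q` converges uniformly to a bounded admissible metric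
`d` on `X`, then `d = d_z` for some `z ∈ Q`. -/
theorem range_dq_closed (q : ℕ → ℝ) (hq : ∀ n, q n ∈ Qset) (d : Xsum × Xsum → ℝ)
    (hd : IsMetricFun d ∧ InducesTopology d ∧ BoundedFun d)
    (hconv : TendstoUniformly (fun n => dq (q n)) d atTop) :
    ∃ z ∈ Qset, d = dq z := by
  obtain ⟨z, hz, φ, hφ, hlim⟩ := isCompact_Icc.tendsto_subseq fun n => (hq n).1
  have hdz : d = dq z := by
    funext p
    exact tendsto_nhds_unique ((hconv.tendsto_at p).comp hφ.tendsto_atTop)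
      (((continuous_dq_apply p).tendsto z).comp hlim)
  refine ⟨z, ⟨hz, ?_⟩, hdz⟩
  by_contra hirr
  exact not_inducesTopology_dq_s9 ⟨hz, hirr⟩ (hdz ▸ hd.2.1)
end

section
/- Let X be a metrizable space. If X contains a closed subset homeomorphic to the space ℙ of irrational numbers (equivalently, to the Baire space ℕ^ℕ), then the space AM(X) of bounded admissible metrics on X, endowed with the sup-metric, is not completely metrizable. -/
open Set Filter Topology UniformConvergence

/-- The metric of `X`, sharpened so that `g` becomes `1`-Lipschitz, with the zero set of `g`
collapsed to a point. -/
def collapseDist {X : Type*} [MetricSpace X] (g : X → ℝ) (p : X × X) : ℝ :=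
  min (dist p.1 p.2 + |g p.1 - g p.2|) (g p.1 + g p.2)

section collapseDist

variable {X : Type*} [MetricSpace X] {g : X → ℝ}

lemma continuous_collapseDist (hg : Continuous g) : Continuous (collapseDist g) := by
  unfold collapseDist
  fun_prop

lemma abs_collapseDist_le {C : ℝ} (h0 : ∀ x, 0 ≤ g x) (hC : ∀ x, g x ≤ C) (p : X × X) :
    |collapseDist g p| ≤ 2 * C := by
  rw [collapseDist, abs_of_nonneg (le_min (by positivity) (add_nonneg (h0 _) (h0 _)))]
  exact (min_le_right _ _).trans (by linarith [hC p.1, hC p.2])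

lemma abs_collapseDist_sub_le {f : X → ℝ} {r : ℝ} (h : ∀ x, |f x - g x| ≤ r) (p : X × X) :
    |collapseDist f p - collapseDist g p| ≤ 2 * r := by
  have h₁ := h p.1
  have h₂ := h p.2
  refine (abs_min_sub_min_le_max _ _ _ _).trans (max_le ?_ ?_)
  · rw [add_sub_add_left_eq_sub]
    refine (abs_abs_sub_abs_le _ _).trans ?_
    rw [abs_le] at *
    constructor <;> linarith
  · rw [abs_le] at *
    constructor <;> linarith

lemma isMetricFun_collapseDist (hg : ∀ x, 0 < g x) : IsMetricFun (collapseDist g) := by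
  refine ⟨fun x y ↦ ⟨fun h ↦ ?_, ?_⟩, fun x y ↦ ?_, fun x y z ↦ ?_⟩
  · have hxy := add_pos (hg x) (hg y)
    rcases min_choice (dist x y + |g x - g y|) (g x + g y) with h' | h' <;>
      simp only [collapseDist, h'] at h
    · exact dist_le_zero.1 (by linarith [abs_nonneg (g x - g y)])
    · linarith
  · rintro rfl
    simp [collapseDist, (hg x).le]
  · simp only [collapseDist, dist_comm x y, abs_sub_comm (g x), add_comm (g x)]
  · have hd := dist_triangle x y z
    have ha := abs_sub_le (g x) (g y) (g z)
    have hx := hg x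
    have hy := hg y
    have hz := hg z
    have h₁ := le_abs_self (g x - g y)
    have h₂ := neg_abs_le (g y - g z)
    simp only [collapseDist]
    rcases min_choice (dist x y + |g x - g y|) (g x + g y) with h | h <;>
    rcases min_choice (dist y z + |g y - g z|) (g y + g z) with h' | h' <;>
    rw [h, h', min_le_iff]
    · left; linarith
    · right; linarith [dist_nonneg (x := x) (y := y)]
    · right; linarith [dist_nonneg (x := y) (y := z)]
    · right; linarith

lemma inducesTopology_collapseDist (hc : Continuous g) (hg : ∀ x, 0 < g x) :
    InducesTopology (collapseDist g) := by
  intro s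
  refine ⟨fun hs x hx ↦ ?_, fun hs ↦ isOpen_iff_mem_nhds.2 fun x hx ↦ ?_⟩
  · obtain ⟨ε, hε, hsub⟩ := Metric.isOpen_iff.1 hs x hx
    refine ⟨min ε (g x), lt_min hε (hg x), fun y hy ↦ hsub ?_⟩
    rw [lt_min_iff, collapseDist, min_lt_iff, min_lt_iff] at hy
    rw [Metric.mem_ball']
    have := hg y
    rcases hy.2 with h | h
    · rcases hy.1 with h' | h'
      · exact lt_of_le_of_lt (le_add_of_nonneg_right (abs_nonneg _)) h'
      · have := abs_nonneg (g x - g y)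
        have := neg_abs_le (g x - g y)
        dsimp only at *
        linarith
    · dsimp only at h
      linarith
  · obtain ⟨ε, hε, hsub⟩ := hs x hx
    have hcont : Continuous fun y ↦ collapseDist g (x, y) :=
      (continuous_collapseDist hc).comp (by fun_prop)
    have h0 : collapseDist g (x, x) < ε := by
      simpa [collapseDist, (hg x).le] using hε
    filter_upwards [hcont.continuousAt.eventually (Iio_mem_nhds h0)] with y hy
    exact hsub y hy

lemma collapseDist_eq_zero_of_eq_zero {x y : X} (hx : g x = 0) (hy : g y = 0) :
    collapseDist g (x, y) = 0 := by
  simp [collapseDist, hx, hy]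

end collapseDist

lemma not_isCompletelyMetrizableSpace_rat : ¬ TopologicalSpace.IsCompletelyMetrizableSpace ℚ := by
  intro h
  let := TopologicalSpace.upgradeIsCompletelyMetrizable ℚ
  obtain ⟨q, hq⟩ := nonempty_interior_of_iUnion_of_closed
    (fun q : ℚ ↦ isClosed_singleton (x := q)) (iUnion_of_singleton ℚ)
  have : (interior {q} : Set ℚ) = {q} :=
    (subset_singleton_iff_eq.1 interior_subset).resolve_left hq.ne_empty
  exact not_isOpen_singleton q (this ▸ isOpen_interior)

lemma not_isCompletelyMetrizableSpace_of_preimage_eq_range_rat {Y : Type*} [TopologicalSpace Y]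
    [T2Space Y] {s : Set Y} {Φ : ℝ → Y} (hΦ : Continuous Φ)
    (h : Φ ⁻¹' s = range ((↑) : ℚ → ℝ)) : ¬ TopologicalSpace.IsCompletelyMetrizableSpace s := by
  intro hs
  have hmem (q : ℚ) : Φ q ∈ s := by
    change (q : ℝ) ∈ Φ ⁻¹' s
    exact h ▸ mem_range_self q
  let j : ℚ → ℝ × s := fun q ↦ (q, ⟨Φ q, hmem q⟩)
  have hj : Continuous j :=
    Rat.continuous_coe_real.prodMk ((hΦ.comp Rat.continuous_coe_real).subtype_mk _)
  have hrange : range j = {p | Φ p.1 = p.2} := by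
    ext ⟨a, b⟩
    refine ⟨?_, fun hab ↦ ?_⟩
    · rintro ⟨q, hq⟩
      obtain ⟨rfl, rfl⟩ := Prod.ext_iff.1 hq
      rfl
    · have ha : a ∈ Φ ⁻¹' s := by
        change Φ a ∈ s
        rw [show Φ a = b from hab]
        exact b.2
      rw [h] at ha
      obtain ⟨q, rfl⟩ := ha
      exact ⟨q, Prod.ext rfl (Subtype.ext hab)⟩
  have hemb : IsClosedEmbedding j := by
    refine ⟨.of_comp hj continuous_fst Rat.isEmbedding_coe_real, ?_⟩
    rw [hrange]
    exact isClosed_eq (by fun_prop) (by fun_prop)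
  exact not_isCompletelyMetrizableSpace_rat hemb.IsCompletelyMetrizableSpace

lemma exists_continuous_not_mem_AM_iff_irrational {X : Type*} [MetricSpace X] {F : Set X}
    (hF : IsClosed F) (e : F ≃ₜ {x : ℝ // Irrational x}) :
    ∃ Φ : ℝ → BoundedContinuousFunction (X × X) ℝ, Continuous Φ ∧
      ∀ a, Φ a ∉ AM X ↔ Irrational a := by
  obtain ⟨H, hH⟩ := ContinuousMap.exists_restrict_eq hF
    (⟨fun x ↦ (e x : ℝ), by fun_prop⟩ : C(F, ℝ))
  replace hH (x : F) : H x = e x := DFunLike.congr_fun hH x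
  have hne : F.Nonempty := ⟨_, (e.symm ⟨_, irrational_sqrt_two⟩).2⟩
  let G (a : ℝ) (x : X) : ℝ := min 1 (|(|a| - |H x|)| + Metric.infDist x F)
  have hGc (a : ℝ) : Continuous (G a) := by
    have := Metric.continuous_infDist_pt F
    fun_prop
  have hG0 (a : ℝ) (x : X) : 0 ≤ G a x :=
    le_min zero_le_one (add_nonneg (abs_nonneg _) Metric.infDist_nonneg)
  have hG1 (a : ℝ) (x : X) : G a x ≤ 1 := min_le_left _ _
  have hGlip (a b : ℝ) (x : X) : |G a x - G b x| ≤ |a - b| := by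
    refine (abs_min_sub_min_le_max _ _ _ _).trans (max_le (by simp) ?_)
    rw [add_sub_add_right_eq_sub]
    refine (abs_abs_sub_abs_le _ _).trans ?_
    rw [sub_sub_sub_cancel_right]
    exact abs_abs_sub_abs_le _ _
  have hGzero (a : ℝ) (x : X) (hx : x ∈ F) (ha : |H x| = |a|) : G a x = 0 := by
    simp [G, ha, Metric.infDist_zero_of_mem hx]
  have hGpos (a : ℝ) (ha : ¬ Irrational a) (x : X) : 0 < G a x := by
    refine lt_min one_pos ((add_nonneg (abs_nonneg _) Metric.infDist_nonneg).lt_of_ne' ?_)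
    intro h0
    have h₁ := abs_nonneg (|a| - |H x|)
    have h₂ := Metric.infDist_nonneg (x := x) (s := F)
    have hx : x ∈ F := (hF.mem_iff_infDist_zero hne).2 (by linarith)
    have hax : |a| = |H x| := sub_eq_zero.1 (abs_eq_zero.1 (by linarith))
    have hirr : Irrational (H x) := by
      rw [hH ⟨x, hx⟩]
      exact (e ⟨x, hx⟩).2
    rcases abs_eq_abs.1 hax with h | h
    · exact ha (h ▸ hirr)
    · exact ha (h ▸ hirr.neg)
  let Φ (a : ℝ) : BoundedContinuousFunction (X × X) ℝ :=
    .ofNormedAddCommGroup (collapseDist (G a)) (continuous_collapseDist (hGc a)) (2 * 1)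
      (abs_collapseDist_le (hG0 a) (hG1 a))
  have hΦ : LipschitzWith 2 Φ := by
    refine LipschitzWith.of_dist_le_mul fun a b ↦ ?_
    refine (BoundedContinuousFunction.dist_le (by positivity)).2 fun p ↦ ?_
    exact abs_collapseDist_sub_le (hGlip a b) p
  refine ⟨Φ, hΦ.continuous, fun a ↦ ⟨fun h ↦ ?_, fun ha h ↦ ?_⟩⟩
  · by_contra ha
    exact h ⟨isMetricFun_collapseDist (hGpos a ha),
      inducesTopology_collapseDist (hGc a) (hGpos a ha)⟩
  · have hpos : Φ a (e.symm ⟨a, ha⟩, e.symm ⟨-a, ha.neg⟩) = 0 :=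
      collapseDist_eq_zero_of_eq_zero (hGzero _ _ (e.symm _).2 (by simp [hH]))
        (hGzero _ _ (e.symm _).2 (by simp [hH]))
    have heq := congr_arg Subtype.val
      (e.symm.injective (Subtype.ext ((h.1.1 _ _).1 hpos)))
    exact ha.ne_zero (self_eq_neg.1 heq)

/-- If a metrizable space `X` contains a closed subset homeomorphic to
the space `ℙ` of irrational numbers, then `AM(X)` with the sup-metric is not completely
metrizable. -/
theorem AM_not_completelyMetrizable_of_closed_copy_of_irrationals (X : Type*)
    [TopologicalSpace X] [TopologicalSpace.MetrizableSpace X] (F : Set X)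
    (hF : IsClosed F) (hhomeo : Nonempty (↥F ≃ₜ {x : ℝ // Irrational x})) :
    ¬ CompletelyMetrizable ↥(AM X) := by
  rintro ⟨m, hm, hcomplete⟩
  obtain ⟨e⟩ := hhomeo
  let := TopologicalSpace.metrizableSpaceMetric X
  obtain ⟨Φ, hΦ, hAM⟩ := exists_continuous_not_mem_AM_iff_irrational hF e
  refine not_isCompletelyMetrizableSpace_of_preimage_eq_range_rat hΦ ?_ ⟨m, hm, hcomplete⟩
  ext a
  exact not_iff_not.1 (hAM a)
end

section
/- Let (Y, ρ) be a bounded metric space, let a ∈ Y, let (a_n) be a sequence of points of Y with a_n ≠ a for all n and a_n → a, and let A = {a_n : n ∈ ℕ} (with the subspace topology from Y, and a ∉ A). Let B' ⊆ Y and let z ∈ Y with z ∉ B'. Define i(z) : (A ⊕ B') × (A ⊕ B') → ℝ by i(z)(x,y) = ρ(x,y) if (x,y) ∈ A² or (x,y) ∈ B'², i(z)(x,y) = ρ(x,a) + ρ(y,z) if x ∈ A and y ∈ B', and i(z)(x,y) = ρ(x,z) + ρ(y,a) if x ∈ B' and y ∈ A. Then i(z) is a bounded metric on the topological sum A ⊕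 B' that induces the sum topology; that is, i(z) ∈ AM(A ⊕ B'). -/
open Set Filter Topology UniformConvergence

/-- The function `i(z)` on the topological sum `A ⊕ B'` of two subspaces of a metric
space `Y`, built from points `a, z ∈ Y`. -/
noncomputable def izfun {Y : Type*} [MetricSpace Y] (A B' : Set Y) (a z : Y) :
    (↥A ⊕ ↥B') × (↥A ⊕ ↥B') → ℝ
  | (Sum.inl x, Sum.inl y) => dist (x : Y) (y : Y)
  | (Sum.inr x, Sum.inr y) => dist (x : Y) (y : Y)
  | (Sum.inl x, Sum.inr y) => dist (x : Y) a + dist (y : Y) z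
  | (Sum.inr x, Sum.inl y) => dist (x : Y) z + dist (y : Y) a

section Izfun

variable {Y : Type*} [MetricSpace Y] {A B' : Set Y} {a z : Y}

theorem isMetricFun_izfun (ha : a ∉ A) (hz : z ∉ B') : IsMetricFun (izfun A B' a z) := by
  have hA : ∀ x : A, 0 < dist (x : Y) a := fun x => dist_pos.2 fun h => ha (h ▸ x.2)
  have hB : ∀ x : B', 0 < dist (x : Y) z := fun x => dist_pos.2 fun h => hz (h ▸ x.2)
  refine ⟨?_, ?_, ?_⟩
  · rintro (x | x) (y | y)
    · simp [izfun, Subtype.ext_iff]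
    · simpa [izfun] using (add_pos (hA x) (hB y)).ne'
    · simpa [izfun] using (add_pos (hB x) (hA y)).ne'
    · simp [izfun, Subtype.ext_iff]
  · rintro (x | x) (y | y) <;> simp only [izfun] <;> first | exact dist_comm _ _ | ring
  · rintro (x | x) (y | y) (w | w) <;> simp only [izfun]
    · exact dist_triangle _ _ _
    · linarith [dist_triangle (x : Y) y a]
    · linarith [dist_triangle_right (x : Y) w a, hB y]
    · linarith [dist_triangle_left (w : Y) z y]
    · linarith [dist_triangle_left (w : Y) a y]
    · linarith [dist_triangle_right (x : Y) w z, hA y]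
    · linarith [dist_triangle (x : Y) y z]
    · exact dist_triangle _ _ _

theorem inducesTopology_izfun (ha : a ∉ A) (hz : z ∉ B') :
    InducesTopology (izfun A B' a z) := by
  have hA : ∀ x : A, 0 < dist (x : Y) a := fun x => dist_pos.2 fun h => ha (h ▸ x.2)
  have hB : ∀ x : B', 0 < dist (x : Y) z := fun x => dist_pos.2 fun h => hz (h ▸ x.2)
  intro s
  rw [isOpen_sum_iff, Metric.isOpen_iff, Metric.isOpen_iff]
  constructor
  · rintro ⟨hl, hr⟩ (x | x) hx
    · obtain ⟨ε, hε, h⟩ := hl x hx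
      refine ⟨min ε (dist (x : Y) a), lt_min hε (hA x), ?_⟩
      rintro (y | y) hy <;> simp only [izfun, lt_min_iff] at hy
      · exact h (Metric.mem_ball'.2 hy.1)
      · linarith [hy.2, hB y]
    · obtain ⟨ε, hε, h⟩ := hr x hx
      refine ⟨min ε (dist (x : Y) z), lt_min hε (hB x), ?_⟩
      rintro (y | y) hy <;> simp only [izfun, lt_min_iff] at hy
      · linarith [hy.2, hA y]
      · exact h (Metric.mem_ball'.2 hy.1)
  · intro h
    refine ⟨fun x hx => ?_, fun x hx => ?_⟩
    · obtain ⟨ε, hε, h⟩ := h _ hx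
      exact ⟨ε, hε, fun y hy => h (Sum.inl y) (Metric.mem_ball'.1 hy)⟩
    · obtain ⟨ε, hε, h⟩ := h _ hx
      exact ⟨ε, hε, fun y hy => h (Sum.inr y) (Metric.mem_ball'.1 hy)⟩

theorem boundedFun_izfun (hbdd : ∃ C : ℝ, ∀ x y : Y, dist x y ≤ C) :
    BoundedFun (izfun A B' a z) := by
  obtain ⟨C, hC⟩ := hbdd
  have hC₀ : 0 ≤ C := dist_nonneg.trans (hC a a)
  refine ⟨C + C, ?_⟩
  rintro ⟨x | x, y | y⟩ <;> simp only [izfun] <;> rw [abs_of_nonneg (by positivity)]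
  · linarith [hC x y]
  · exact add_le_add (hC _ _) (hC _ _)
  · exact add_le_add (hC _ _) (hC _ _)
  · linarith [hC x y]

end Izfun

/-- Let `(Y, ρ)` be a bounded metric space, `a ∈ Y`, `(aₙ)` a sequence
of points distinct from `a` converging to `a`, `A = {aₙ : n ∈ ℕ}`, `B' ⊆ Y` and
`z ∈ Y \ B'`. Then `i(z)` is a bounded metric on the topological sum `A ⊕ B'` inducing
the sum topology, i.e. `i(z) ∈ AM(A ⊕ B')`. -/
theorem izfun_mem_AM {Y : Type*} [MetricSpace Y] (hbdd : ∃ C : ℝ, ∀ x y : Y, dist x y ≤ C)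
    (a : Y) (aseq : ℕ → Y) (hne : ∀ n, aseq n ≠ a) (hlim : Tendsto aseq atTop (𝓝 a))
    (B' : Set Y) (z : Y) (hz : z ∉ B') :
    IsMetricFun (izfun (Set.range aseq) B' a z) ∧
      InducesTopology (izfun (Set.range aseq) B' a z) ∧
        BoundedFun (izfun (Set.range aseq) B' a z) := by
  have ha : a ∉ Set.range aseq := by
    rintro ⟨n, hn⟩
    exact hne n hn
  exact ⟨isMetricFun_izfun ha hz, inducesTopology_izfun ha hz, boundedFun_izfun hbdd⟩
end

section
/- Let (Y, ρ) be a bounded metric space, let a ∈ Y, let (a_n) be a sequence of points of Y with a_n ≠ a for all n and a_n → a, let A = {a_n : n ∈ ℕ}, and let B' ⊆ Y. For z ∈ Y \ B' define i(z) : (A ⊕ B') × (A ⊕ B') → ℝ by i(z)(x,y) = ρ(x,y) if (x,y) ∈ A² or (x,y) ∈ B'², i(z)(x,y) = ρ(x,a) + ρ(y,z) if x ∈ A and y ∈ B', and i(z)(x,y) = ρ(x,z) + ρ(y,a) if x ∈ B' and y ∈ A. Then for all z₁, z₂ ∈ Y \ B' lying in the closure of B' in Y, the sup-metric distance D(i(z₁),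 i(z₂)) = sup{|i(z₁)(x,y) − i(z₂)(x,y)| : (x,y) ∈ (A ⊕ B')²} satisfies ρ(z₁, z₂)/3 ≤ D(i(z₁), i(z₂)) ≤ ρ(z₁, z₂); in particular, z ↦ i(z) is continuous and injective on cl_Y(B') \ B'. -/
open Set Filter Topology UniformConvergence

/-- Moving the base point `z` changes `izfun` by at most the displacement of `z`. -/
theorem abs_izfun_sub_izfun_le {Y : Type*} [MetricSpace Y] (A B' : Set Y) (a z₁ z₂ : Y)
    (p : (↥A ⊕ ↥B') × (↥A ⊕ ↥B')) :
    |izfun A B' a z₁ p - izfun A B' a z₂ p| ≤ dist z₁ z₂ := by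
  have hdist (x : Y) : |dist x z₁ - dist x z₂| ≤ dist z₁ z₂ := by
    simpa only [dist_comm x] using abs_dist_sub_le z₁ z₂ x
  rcases p with ⟨x | x, y | y⟩ <;> simp [izfun, hdist]

/-- With `(Y, ρ)`, `a`, `(aₙ)`, `A = {aₙ : n ∈ ℕ}` and `B' ⊆ Y` as
before, for all `z₁, z₂ ∈ cl_Y(B') \ B'` the sup-metric distance between `i(z₁)` and
`i(z₂)` satisfies `ρ(z₁,z₂)/3 ≤ D(i(z₁), i(z₂)) ≤ ρ(z₁,z₂)`; in particular `z ↦ i(z)`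
is continuous and injective on `cl_Y(B') \ B'`. -/
theorem dist_izfun_bounds {Y : Type*} [MetricSpace Y]
    (hbdd : ∃ C : ℝ, ∀ x y : Y, dist x y ≤ C)
    (a : Y) (aseq : ℕ → Y) (hne : ∀ n, aseq n ≠ a) (hlim : Tendsto aseq atTop (𝓝 a))
    (B' : Set Y) (z₁ z₂ : Y) (hz₁ : z₁ ∈ closure B' \ B') (hz₂ : z₂ ∈ closure B' \ B') :
    dist z₁ z₂ / 3 ≤
        (⨆ p : (↥(Set.range aseq) ⊕ ↥B') × (↥(Set.range aseq) ⊕ ↥B'),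
          |izfun (Set.range aseq) B' a z₁ p - izfun (Set.range aseq) B' a z₂ p|) ∧
      (⨆ p : (↥(Set.range aseq) ⊕ ↥B') × (↥(Set.range aseq) ⊕ ↥B'),
          |izfun (Set.range aseq) B' a z₁ p - izfun (Set.range aseq) B' a z₂ p|) ≤
        dist z₁ z₂ := by
  have hle := abs_izfun_sub_izfun_le (Set.range aseq) B' a z₁ z₂
  have hbound : BddAbove (Set.range fun p : (↥(Set.range aseq) ⊕ ↥B') × (↥(Set.range aseq) ⊕ ↥B') =>
      |izfun (Set.range aseq) B' a z₁ p - izfun (Set.range aseq) B' a z₂ p|) :=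
    ⟨dist z₁ z₂, by rintro _ ⟨p, rfl⟩; exact hle p⟩
  refine ⟨?_, Real.iSup_le hle dist_nonneg⟩
  rcases (dist_nonneg (x := z₁) (y := z₂)).eq_or_lt with h0 | hpos
  · rw [← h0, zero_div]
    exact Real.iSup_nonneg fun _ => abs_nonneg _
  obtain ⟨b, hb, hzb⟩ := Metric.mem_closure_iff.1 hz₁.1 (dist z₁ z₂ / 3) (by positivity)
  refine le_trans ?_ (le_ciSup hbound (Sum.inl ⟨aseq 0, 0, rfl⟩, Sum.inr ⟨b, hb⟩))
  simp only [izfun]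
  rw [abs_sub_comm]
  refine le_trans ?_ (le_abs_self _)
  linarith [dist_triangle z₁ b z₂, dist_comm z₁ b]
end
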